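/- arXiv:1907.01720 — 2 statements merged into one kernel-verified Lean document; each statement's English description precedes it below -/
import Mathlib

section
/- Let α ≥ 3 be an integer and let G be a graph on n vertices whose independence number equals α. Then G contains an immersion of a complete graph on at least ⌊n/(2.25·α − f(α))⌋ − 1 vertices, where f(3) = f(4) = 2.25 and f(α) = 2.25 + Σ_{i=6}^{α+1} 1/(2i) for α ≥ 5. -/
/-- `G` contains an immersion of a complete graph on `k` vertices: there are `k`
distinct branch vertices `φ u`, and for every pair `u < v` (i.e. every edge of `K_k`)
a path `P u v` joining `φ u` and `φ v`, the paths being pairwise edge-disjoint. -/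
def CliqueImmersion {V : Type*} (G : SimpleGraph V) (k : ℕ) : Prop :=
  ∃ (φ : Fin k → V) (P : ∀ u v : Fin k, G.Walk (φ u) (φ v)),
    Function.Injective φ ∧
    (∀ u v : Fin k, u < v → (P u v).IsPath) ∧
    (∀ u v u' v' : Fin k, u < v → u' < v' → (u, v) ≠ (u', v') →
      ∀ e ∈ (P u v).edges, e ∉ (P u' v').edges)

/-- The independence number of `G` equals `a`. -/
def IndepNumEq {V : Type*} (G : SimpleGraph V) (a : ℕ) : Prop :=
  (∃ I : Finset V, (I : Set V).Pairwise (fun x y => ¬ G.Adj x y) ∧ I.card = a) ∧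
  ∀ I : Finset V, (I : Set V).Pairwise (fun x y => ¬ G.Adj x y) → I.card ≤ a

/-- The function `f` of the main theorem: `f 3 = f 4 = 2.25` and
`f α = 2.25 + ∑_{i=6}^{α+1} 1/(2i)` for `α ≥ 5`. -/
def fMain (a : ℕ) : ℚ :=
  if a ≤ 4 then 9 / 4
  else 9 / 4 + ∑ i ∈ Finset.Icc 6 (a + 1), 1 / (2 * (i : ℚ))

section Helpers
open scoped Classical

lemma flow_aux {N ι : Type*} [Fintype N] [Fintype ι] (u : N) : ∀ (k : ℕ) (E : Finset (N × N)) (p : ι → N),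
    E.card = k →
    (∀ Q : Finset N, u ∉ Q → (∑ i, if p i ∈ Q then 1 else 0) ≤
      ∑ e ∈ E, if e.1 ∈ Q ∧ e.2 ∉ Q then 1 else 0) →
    ∃ A : ι → Finset (N × N), (∀ i, A i ⊆ E) ∧ (∀ i j, i ≠ j → Disjoint (A i) (A j)) ∧
      ∀ i, Relation.ReflTransGen (fun a b => (a, b) ∈ A i) (p i) u := by
  intro k
  induction k with
  | zero =>
    intro E p hE h
    have hE : E = ∅ := Finset.card_eq_zero.mp hE
    subst hE
    refine ⟨fun _ => ∅, by simp, by simp, fun i => ?_⟩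
    have : p i = u := by
      by_contra hne
      have := h {p i} (by simpa using Ne.symm hne)
      simp only [Finset.sum_empty, Nat.le_zero, Finset.sum_eq_zero_iff] at this
      have := this i (Finset.mem_univ _)
      simp at this
    rw [this]
  | succ k ih =>
    intro E p hE h
    by_cases hall : ∀ i, p i = u
    · exact ⟨fun _ => ∅, by simp, by simp, fun i => by rw [hall i]⟩
    push Not at hall
    obtain ⟨i, hi⟩ := hall
    set v := p i with hv
    set D : Finset N → ℕ := fun Q => ∑ i, if p i ∈ Q then 1 else 0 with hD
    set d : Finset N → ℕ := fun Q => ∑ e ∈ E, if e.1 ∈ Q ∧ e.2 ∉ Q then 1 else 0 with hd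
    have h' : ∀ Q : Finset N, u ∉ Q → D Q ≤ d Q := h
    have Dmod : ∀ Q T, D (Q ∪ T) + D (Q ∩ T) = D Q + D T := by
      intro Q T
      simp only [hD, ← Finset.sum_add_distrib]
      refine Finset.sum_congr rfl fun j _ => ?_
      by_cases h1 : p j ∈ Q <;> by_cases h2 : p j ∈ T <;> simp [h1, h2]
    have dsub : ∀ Q T, d (Q ∪ T) + d (Q ∩ T) ≤ d Q + d T := by
      intro Q T
      simp only [hd, ← Finset.sum_add_distrib]
      refine Finset.sum_le_sum fun e _ => ?_
      by_cases h1 : e.1 ∈ Q <;> by_cases h2 : e.1 ∈ T <;> by_cases h3 : e.2 ∈ Q <;>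
        by_cases h4 : e.2 ∈ T <;> simp [h1, h2, h3, h4]
    -- maximal tight set
    let 𝒯 : Finset (Finset N) := Finset.univ.filter fun Q => u ∉ Q ∧ v ∉ Q ∧ D Q = d Q
    have hne : 𝒯.Nonempty := ⟨∅, by simp [𝒯, hD, hd]⟩
    obtain ⟨T, hT, hmax⟩ := Finset.exists_max_image 𝒯 Finset.card hne
    have hT' : u ∉ T ∧ v ∉ T ∧ D T = d T := by simpa [𝒯] using hT
    obtain ⟨hTu, hTv, hTt⟩ := hT'
    have hsubT : ∀ Q, u ∉ Q → v ∉ Q → D Q = d Q → Q ⊆ T := by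
      intro Q h1 h2 h3
      have hu : u ∉ Q ∪ T := by simp [h1, hTu]
      have hi : u ∉ Q ∩ T := by simp [h1]
      have e1 := h' _ hu
      have e2 := h' _ hi
      have e3 := Dmod Q T
      have e4 := dsub Q T
      have : Q ∪ T ∈ 𝒯 := by
        simp only [𝒯, Finset.mem_filter, Finset.mem_univ, true_and]
        refine ⟨hu, by simp [h2, hTv], by omega⟩
      have hc := hmax _ this
      have : T = Q ∪ T := Finset.eq_of_subset_of_card_le Finset.subset_union_right hc
      rw [this]; exact Finset.subset_union_left
    have hw : ∃ w, (v, w) ∈ E ∧ w ∉ T ∧ w ≠ v := by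
      by_contra hcon
      push Not at hcon
      have hu : u ∉ insert v T := by simp [hTu, Ne.symm hi]
      have e1 := h' _ hu
      have e2 : D T < D (insert v T) := by
        simp only [hD]
        refine Finset.sum_lt_sum (fun j _ => ?_) ⟨i, Finset.mem_univ _, ?_⟩
        · by_cases h1 : p j ∈ T <;> simp [h1]
        · simp [← hv, hTv]
      have e3 : d (insert v T) ≤ d T := by
        simp only [hd]
        refine Finset.sum_le_sum fun e he => ?_
        by_cases h1 : e.1 = v
        · have : (v, e.2) ∈ E := by rw [← h1]; exact he
          have := hcon e.2 this
          by_cases h2 : e.2 ∈ T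
          · simp [h2]
          · simp [this h2]
        · by_cases h2 : e.1 ∈ T <;> by_cases h3 : e.2 ∈ T <;> by_cases h4 : e.2 = v <;>
            simp [h1, h2, h3, h4]
      omega
    obtain ⟨w, hwE, hwT, hwv⟩ := hw
    have hcond : (∀ Q : Finset N, u ∉ Q → (∑ j, if (Function.update p i w) j ∈ Q then 1 else 0) ≤
      ∑ e ∈ E.erase (v, w), if e.1 ∈ Q ∧ e.2 ∉ Q then 1 else 0) := by
      intro Q hQ
      have e1 := h' Q hQ
      have e2 : d Q = (if v ∈ Q ∧ w ∉ Q then 1 else 0) +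
          ∑ e ∈ E.erase (v, w), if e.1 ∈ Q ∧ e.2 ∉ Q then 1 else 0 := by
        simp only [hd]; rw [← Finset.add_sum_erase _ _ hwE]
      have e3 : D Q = (if v ∈ Q then 1 else 0) +
          ∑ j ∈ Finset.univ.erase i, if p j ∈ Q then 1 else 0 := by
        simp only [hD]; rw [← Finset.add_sum_erase _ _ (Finset.mem_univ i)]
      have e4 : (∑ j, if (Function.update p i w) j ∈ Q then 1 else 0) = (if w ∈ Q then 1 else 0) +
          ∑ j ∈ Finset.univ.erase i, if p j ∈ Q then 1 else 0 := by
        rw [← Finset.add_sum_erase _ _ (Finset.mem_univ i)]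
        congr 1
        · simp
        · refine Finset.sum_congr rfl fun j hj => ?_
          rw [Function.update_of_ne (Finset.ne_of_mem_erase hj)]
      have e5 : w ∈ Q → v ∉ Q → D Q ≠ d Q := by
        intro h1 h2 h3
        exact hwT (hsubT Q hQ h2 h3 h1)
      rw [e4]
      by_cases h1 : w ∈ Q <;> by_cases h2 : v ∈ Q <;> simp [h1, h2] at e2 e3 e5 ⊢ <;> omega
    obtain ⟨A, hA1, hA2, hA3⟩ := ih (E.erase (v, w)) (Function.update p i w)
      (by rw [Finset.card_erase_of_mem hwE, hE]; rfl) hcond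
    have hvw : ∀ j, (v, w) ∉ A j := fun j hj => by simpa using hA1 j hj
    refine ⟨Function.update A i (insert (v, w) (A i)), ?_, ?_, ?_⟩
    · intro j
      by_cases hj : j = i
      · subst hj
        simp only [Function.update_self]
        exact Finset.insert_subset hwE ((hA1 j).trans (Finset.erase_subset _ _))
      · rw [Function.update_of_ne hj]; exact (hA1 j).trans (Finset.erase_subset _ _)
    · intro j l hjl
      by_cases hj : j = i
      · subst hj
        rw [Function.update_self, Function.update_of_ne hjl.symm, Finset.disjoint_insert_left]
        exact ⟨hvw l, hA2 _ _ hjl⟩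
      · by_cases hl : l = i
        · subst hl
          rw [Function.update_self, Function.update_of_ne hjl, Finset.disjoint_insert_right]
          exact ⟨hvw j, hA2 _ _ hjl⟩
        · rw [Function.update_of_ne hj, Function.update_of_ne hl]; exact hA2 _ _ hjl
    · intro j
      by_cases hj : j = i
      · subst hj
        rw [Function.update_self]
        have := hA3 j
        rw [Function.update_self] at this
        refine Relation.ReflTransGen.head (b := w) (by simp [hv]) ?_
        exact Relation.ReflTransGen.mono (fun a b hab => Finset.mem_insert_of_mem hab) _ _ this
      · have := hA3 j
        rw [Function.update_of_ne hj] at this ⊢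
        exact this


def ImmX {V : Type*} (G : SimpleGraph V) (Y : Finset V) (t : ℕ) : Prop :=
  ∃ (M : Finset V) (F : Sym2 V → SimpleGraph V), M ⊆ Y ∧ M.card = t ∧
    (∀ a ∈ M, ∀ b ∈ M, a ≠ b →
      (∀ x y, (F s(a, b)).Adj x y → G.Adj x y ∧ x ∈ Y ∧ y ∈ Y) ∧ (F s(a, b)).Reachable a b) ∧
    (∀ a ∈ M, ∀ b ∈ M, ∀ c ∈ M, ∀ d ∈ M, a ≠ b → c ≠ d → s(a, b) ≠ s(c, d) →
      ∀ x y, (F s(a, b)).Adj x y → ¬ (F s(c, d)).Adj x y)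

lemma imm_mono {V : Type*} {G : SimpleGraph V} {Y Z : Finset V} {t : ℕ} (h : ImmX G Y t)
    (hYZ : Y ⊆ Z) : ImmX G Z t := by
  obtain ⟨M, F, h1, h2, h3, h4⟩ := h
  refine ⟨M, F, h1.trans hYZ, h2, fun a ha b hb hab => ⟨fun x y hxy => ?_, (h3 a ha b hb hab).2⟩, h4⟩
  obtain ⟨p, q, r⟩ := (h3 a ha b hb hab).1 x y hxy
  exact ⟨p, hYZ q, hYZ r⟩

lemma imm_clique {V : Type*} {G : SimpleGraph V} {Y : Finset V} {t : ℕ}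
    (hc : ∀ x ∈ Y, ∀ y ∈ Y, x ≠ y → G.Adj x y) (ht : t ≤ Y.card) : ImmX G Y t := by
  obtain ⟨M, hM, hMt⟩ := Finset.exists_subset_card_eq ht
  refine ⟨M, fun p => SimpleGraph.fromEdgeSet {p}, hM, hMt, ?_, ?_⟩
  · intro a ha b hb hab
    refine ⟨?_, ?_⟩
    · intro x y hxy
      simp only [SimpleGraph.fromEdgeSet_adj, Set.mem_singleton_iff, Sym2.eq_iff] at hxy
      obtain ⟨⟨rfl, rfl⟩ | ⟨rfl, rfl⟩, hne⟩ := hxy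
      · exact ⟨hc _ (hM ha) _ (hM hb) hne, hM ha, hM hb⟩
      · exact ⟨hc _ (hM hb) _ (hM ha) hne, hM hb, hM ha⟩
    · exact SimpleGraph.Adj.reachable (by simp [hab])
  · intro a _ b _ c _ d _ _ _ hne x y h1 h2
    simp only [SimpleGraph.fromEdgeSet_adj, Set.mem_singleton_iff] at h1 h2
    exact hne (h1.1.symm.trans h2.1)

lemma imm_extend {V : Type*} {G : SimpleGraph V} {Y Z N : Finset V} {t k : ℕ} (h : ImmX G Y t)
    (hYZ : Y ⊆ Z) (hNZ : N ⊆ Z) (hN : Disjoint Y N) (hk : N.card = k)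
    (hK : ∀ M ⊆ Y, M.card = t → ∃ K : Sym2 V → SimpleGraph V,
      (∀ a ∈ M ∪ N, ∀ b ∈ N, a ≠ b →
        (∀ x y, (K s(a, b)).Adj x y → G.Adj x y ∧ x ∈ Z ∧ y ∈ Z ∧ (x ∉ Y ∨ y ∉ Y)) ∧
        (K s(a, b)).Reachable a b) ∧
      (∀ a ∈ M ∪ N, ∀ b ∈ N, ∀ c ∈ M ∪ N, ∀ d ∈ N, a ≠ b → c ≠ d → s(a, b) ≠ s(c, d) →
        ∀ x y, (K s(a, b)).Adj x y → ¬ (K s(c, d)).Adj x y)) : ImmX G Z (t + k) := by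
  obtain ⟨M, F, h1, h2, h3, h4⟩ := h
  obtain ⟨K, k1, k2⟩ := hK M h1 h2
  have hNY : ∀ b ∈ N, b ∉ Y := fun b hb hY => Finset.disjoint_left.mp hN hY hb
  have hMN : Disjoint M N := Finset.disjoint_of_subset_left h1 hN
  have key : ∀ a ∈ M ∪ N, ∀ b ∈ M ∪ N, (a ∈ M ∧ b ∈ M) ∨
      (∃ c ∈ M ∪ N, ∃ d ∈ N, s(a, b) = s(c, d)) := by
    intro a ha b hb
    by_cases hbN : b ∈ N
    · exact Or.inr ⟨a, ha, b, hbN, rfl⟩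
    by_cases haN : a ∈ N
    · exact Or.inr ⟨b, hb, a, haN, Sym2.eq_swap⟩
    · left
      simp only [Finset.mem_union] at ha hb
      tauto
  have Fin' : ∀ a ∈ M, ∀ b ∈ M, (∀ z ∈ s(a, b), z ∈ Y) := by
    intro a ha b hb z hz
    rcases Sym2.mem_iff.mp hz with rfl | rfl
    · exact h1 ha
    · exact h1 hb
  have Kout : ∀ c, ∀ d ∈ N, ¬ (∀ z ∈ s(c, d), z ∈ Y) := by
    intro c d hd hz
    exact hNY d hd (hz d (Sym2.mem_mk_right _ _))
  refine ⟨M ∪ N, fun p => if (∀ z ∈ p, z ∈ Y) then F p else K p,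
    Finset.union_subset (h1.trans hYZ) hNZ, ?_, ?_, ?_⟩
  · rw [Finset.card_union_of_disjoint hMN, h2, hk]
  · intro a ha b hb hab
    rcases key a ha b hb with ⟨ha', hb'⟩ | ⟨c, hc, d, hd, he⟩
    · simp only [if_pos (Fin' a ha' b hb')]
      refine ⟨fun x y hxy => ?_, (h3 a ha' b hb' hab).2⟩
      obtain ⟨p, q, r⟩ := (h3 a ha' b hb' hab).1 x y hxy
      exact ⟨p, hYZ q, hYZ r⟩
    · have hcd : c ≠ d := by
        rintro rfl
        rcases Sym2.eq_iff.mp he with ⟨rfl, rfl⟩ | ⟨rfl, rfl⟩ <;> exact hab rfl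
      have := k1 c hc d hd hcd
      simp only [he, if_neg (Kout c d hd)]
      refine ⟨fun x y hxy => ?_, ?_⟩
      · obtain ⟨p, q, r, _⟩ := this.1 x y hxy
        exact ⟨p, q, r⟩
      · rcases Sym2.eq_iff.mp he with ⟨rfl, rfl⟩ | ⟨rfl, rfl⟩
        · exact this.2
        · exact this.2.symm
  · intro a ha b hb a' ha' b' hb' hab hab' hne x y h5 h6
    rcases key a ha b hb with ⟨ha1, hb1⟩ | ⟨c, hc, d, hd, he⟩ <;>
    rcases key a' ha' b' hb' with ⟨ha1', hb1'⟩ | ⟨c', hc', d', hd', he'⟩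
    · simp only [if_pos (Fin' a ha1 b hb1), if_pos (Fin' a' ha1' b' hb1')] at h5 h6
      exact h4 a ha1 b hb1 a' ha1' b' hb1' hab hab' hne x y h5 h6
    · have hcd : c' ≠ d' := by
        rintro rfl
        rcases Sym2.eq_iff.mp he' with ⟨rfl, rfl⟩ | ⟨rfl, rfl⟩ <;> exact hab' rfl
      rw [he'] at h6
      simp only [if_pos (Fin' a ha1 b hb1), if_neg (Kout c' d' hd')] at h5 h6
      have q := (h3 a ha1 b hb1 hab).1 x y h5
      have q' := (k1 c' hc' d' hd' hcd).1 x y h6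
      tauto
    · have hcd : c ≠ d := by
        rintro rfl
        rcases Sym2.eq_iff.mp he with ⟨rfl, rfl⟩ | ⟨rfl, rfl⟩ <;> exact hab rfl
      rw [he] at h5
      simp only [if_pos (Fin' a' ha1' b' hb1'), if_neg (Kout c d hd)] at h5 h6
      have q := (h3 a' ha1' b' hb1' hab').1 x y h6
      have q' := (k1 c hc d hd hcd).1 x y h5
      tauto
    · have hcd : c ≠ d := by
        rintro rfl
        rcases Sym2.eq_iff.mp he with ⟨rfl, rfl⟩ | ⟨rfl, rfl⟩ <;> exact hab rfl
      have hcd' : c' ≠ d' := by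
        rintro rfl
        rcases Sym2.eq_iff.mp he' with ⟨rfl, rfl⟩ | ⟨rfl, rfl⟩ <;> exact hab' rfl
      rw [he] at h5 hne
      rw [he'] at h6 hne
      simp only [if_neg (Kout c d hd), if_neg (Kout c' d' hd')] at h5 h6
      exact k2 c hc d hd c' hc' d' hd' hcd hcd' hne x y h5 h6

/-- flow routing -/
lemma route {V : Type*} [Fintype V] (G : SimpleGraph V) (X M W : Finset V) (u : V) (hu : u ∈ X)
    (hXM : ∀ x ∈ X, x ∉ M) (hXW : ∀ x ∈ X, x ∉ W) (hMW : ∀ x ∈ M, x ∉ W)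
    (hdom : ∀ m ∈ M, ∃ x ∈ X, G.Adj m x)
    (hmix : ∀ X' ⊆ X, u ∈ X' → X' ≠ X → M.card ≤ ((M ∪ W).filter
      (fun y => (∃ x ∈ X', G.Adj y x) ∧ ∃ x ∈ X, x ∉ X' ∧ G.Adj y x)).card) :
    ∃ B : V → Finset V, (∀ m, B m ⊆ W) ∧ (∀ m ∈ M, ∀ m' ∈ M, m ≠ m' → Disjoint (B m) (B m')) ∧
      ∀ m ∈ M, (SimpleGraph.fromRel fun a b => G.Adj a b ∧ b ∈ X ∧
        (a = m ∨ a ∈ B m)).Reachable m u := by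
  let arc : (V × Bool) × (V × Bool) → Prop := fun e =>
    (e.1.1 ∈ X ∧ e.1.2 = false ∧ e.2.1 ∈ W ∧ e.2.2 = false ∧ G.Adj e.1.1 e.2.1) ∨
    (e.1.1 ∈ W ∧ e.1.2 = false ∧ e.2.1 = e.1.1 ∧ e.2.2 = true) ∨
    (e.1.1 ∈ W ∧ e.1.2 = true ∧ e.2.1 ∈ X ∧ e.2.2 = false ∧ G.Adj e.1.1 e.2.1) ∨
    (e.1.1 ∈ M ∧ e.1.2 = false ∧ e.2.1 ∈ X ∧ e.2.2 = false ∧ G.Adj e.1.1 e.2.1)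
  let E : Finset ((V × Bool) × (V × Bool)) := Finset.univ.filter arc
  have hE : ∀ e, e ∈ E ↔ arc e := fun e => by simp [E]
  let lab : (V × Bool) × (V × Bool) → V := fun e => if e.1.1 ∈ X then e.2.1 else e.1.1
  obtain ⟨A, hA1, hA2, hA3⟩ := flow_aux (ι := {m // m ∈ M}) (u, false) _ E (fun m => (m.1, false)) rfl (by
    intro Q hQ
    have l1 : (∑ i : {m // m ∈ M}, if ((i.1, false) : V × Bool) ∈ Q then 1 else 0) =
        (M.filter fun m => (m, false) ∈ Q).card := by
      rw [Finset.card_filter]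
      exact Finset.sum_coe_sort M (fun m => if ((m, false) : V × Bool) ∈ Q then 1 else 0)
    refine le_trans (b := (M.filter fun m => (m, false) ∈ Q).card) (le_of_eq (by convert l1)) (le_trans ?_ (le_of_eq
      (show (E.filter fun e => e.1 ∈ Q ∧ e.2 ∉ Q).card = _ by rw [Finset.card_filter]; congr!)))
    suffices hs : ∃ T : Finset V, (M.filter fun m => (m, false) ∈ Q).card ≤ T.card ∧
        ∀ y ∈ T, ∃ e, arc e ∧ e.1 ∈ Q ∧ e.2 ∉ Q ∧ lab e = y by
      obtain ⟨T, hT1, hT2⟩ := hs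
      refine hT1.trans (le_trans (Finset.card_le_card ?_) (Finset.card_image_le (f := lab)))
      intro y hy
      obtain ⟨e, h1, h2, h3, h4⟩ := hT2 y hy
      rw [Finset.mem_image]
      exact ⟨e, by rw [Finset.mem_filter]; exact ⟨(hE e).2 h1, h2, h3⟩, h4⟩
    have hMX : ∀ m ∈ M, m ∉ X := fun m hm hx => hXM m hx hm
    have hWX : ∀ m ∈ W, m ∉ X := fun m hm hx => hXW m hx hm
    let X' := X.filter fun x => (x, false) ∉ Q
    by_cases hX' : X' = X
    · refine ⟨M.filter fun m => (m, false) ∈ Q, le_rfl, ?_⟩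
      intro m hm
      rw [Finset.mem_filter] at hm
      obtain ⟨x, hx, hmx⟩ := hdom m hm.1
      have hx' : x ∈ X' := hX' ▸ hx
      refine ⟨((m, false), (x, false)), Or.inr (Or.inr (Or.inr ⟨hm.1, rfl, hx, rfl, hmx⟩)), hm.2,
        (Finset.mem_filter.mp hx').2, ?_⟩
      simp [lab, hMX m hm.1]
    · have hm := hmix X' (Finset.filter_subset _ _) (by simp [X', hu, hQ]) hX'
      set mixed := ((M ∪ W).filter
        (fun y => (∃ x ∈ X', G.Adj y x) ∧ ∃ x ∈ X, x ∉ X' ∧ G.Adj y x)) with hmixed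
      refine ⟨mixed \ (M.filter fun m => (m, false) ∉ Q), ?_, ?_⟩
      · have c1 := Finset.le_card_sdiff (M.filter fun m => (m, false) ∉ Q) mixed
        have c2 := Finset.card_filter_add_card_filter_not (s := M) (fun m => (m, false) ∈ Q)
        omega
      · intro y hy
        simp only [hmixed, Finset.mem_sdiff, Finset.mem_filter, Finset.mem_union, not_and, not_not] at hy
        obtain ⟨⟨hy1, ⟨x, hx, hyx⟩, ⟨x2, hx2, hx2', hyx2⟩⟩, hy2⟩ := hy
        have hx' := Finset.mem_filter.mp hx
        have hx2Q : (x2, false) ∈ Q := by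
          by_contra hcon
          exact hx2' (Finset.mem_filter.mpr ⟨hx2, hcon⟩)
        rcases hy1 with hy1 | hy1
        · refine ⟨((y, false), (x, false)), Or.inr (Or.inr (Or.inr ⟨hy1, rfl, hx'.1, rfl, hyx⟩)),
            hy2 hy1, hx'.2, ?_⟩
          simp [lab, hMX y hy1]
        · by_cases q1 : (y, false) ∈ Q
          · by_cases q2 : (y, true) ∈ Q
            · refine ⟨((y, true), (x, false)), Or.inr (Or.inr (Or.inl ⟨hy1, rfl, hx'.1, rfl, hyx⟩)),
                q2, hx'.2, ?_⟩
              simp [lab, hWX y hy1]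
            · refine ⟨((y, false), (y, true)), Or.inr (Or.inl ⟨hy1, rfl, rfl, rfl⟩),
                q1, q2, ?_⟩
              simp [lab]
          · refine ⟨((x2, false), (y, false)), Or.inl ⟨hx2, rfl, hy1, rfl, hyx2.symm⟩,
                hx2Q, q1, ?_⟩
            simp [lab, hx2])
  refine ⟨fun m => if hm : m ∈ M then W.filter (fun w => ((w, false), (w, true)) ∈ A ⟨m, hm⟩) else ∅,
    ?_, ?_, ?_⟩
  · intro m
    by_cases hm : m ∈ M
    · simp only [hm, dif_pos]; exact Finset.filter_subset _ _
    · simp [hm]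
  · intro m hm m' hm' hne
    simp only [hm, hm', dif_pos]
    rw [Finset.disjoint_left]
    intro w h1 h2
    rw [Finset.mem_filter] at h1 h2
    exact Finset.disjoint_left.mp (hA2 ⟨m, hm⟩ ⟨m', hm'⟩ (by simpa using hne)) h1.2 h2.2
  · intro m hm
    simp only [hm, dif_pos]
    set H := SimpleGraph.fromRel fun a b => G.Adj a b ∧ b ∈ X ∧
        (a = m ∨ a ∈ W.filter (fun w => ((w, false), (w, true)) ∈ A ⟨m, hm⟩)) with hH
    have hAdj : ∀ a b, G.Adj a b → b ∈ X → (a = m ∨ a ∈ W.filter (fun w => ((w, false), (w, true)) ∈ A ⟨m, hm⟩)) → H.Adj a b := by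
      intro a b h1 h2 h3
      rw [hH, SimpleGraph.fromRel_adj]
      exact ⟨h1.ne, Or.inl ⟨h1, h2, h3⟩⟩
    have main : ∀ n : V × Bool, Relation.ReflTransGen (fun a b => (a, b) ∈ A ⟨m, hm⟩) n (u, false) →
        (n.2 = false → n.1 ∈ X → H.Reachable n.1 u) ∧
        (n.2 = true → n.1 ∈ W → ∃ x ∈ X, G.Adj n.1 x ∧ H.Reachable x u) ∧
        (n.2 = false → n.1 ∈ W → ((n.1, false), (n.1, true)) ∈ A ⟨m, hm⟩ ∧
          ∃ x ∈ X, G.Adj n.1 x ∧ H.Reachable x u) ∧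
        (n.2 = false → n.1 = m → H.Reachable m u) := by
      intro n hn
      induction hn using Relation.ReflTransGen.head_induction_on with
      | refl =>
        refine ⟨fun _ _ => SimpleGraph.Reachable.refl _, by simp, fun _ h => absurd h (hXW u hu), ?_⟩
        rintro _ h
        simp only at h
        exact absurd hm (h ▸ hXM u hu)
      | @head a c h1 hr ih =>
        clear hr
        have harc := (hE _).1 (hA1 _ h1)
        obtain ⟨a1, a2⟩ := a
        obtain ⟨c1, c2⟩ := c
        simp only [arc] at harc
        simp only at ih ⊢
        obtain ⟨i1, i2, i3, i4⟩ := ih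
        rcases harc with ⟨p1, rfl, p3, rfl, p5⟩ | ⟨p1, rfl, rfl, rfl⟩ | ⟨p1, rfl, p3, rfl, p5⟩ | ⟨p1, rfl, p3, rfl, p5⟩
        · refine ⟨fun _ _ => ?_, by simp, fun _ h => absurd h (hXW _ p1), ?_⟩
          · obtain ⟨q1, x, hx, q2, q3⟩ := i3 rfl p3
            have hc : c1 ∈ W.filter (fun w => ((w, false), (w, true)) ∈ A ⟨m, hm⟩) :=
              Finset.mem_filter.mpr ⟨p3, q1⟩
            exact ((hAdj _ _ p5.symm p1 (Or.inr hc)).symm.reachable.trans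
              (hAdj _ _ q2 hx (Or.inr hc)).reachable).trans q3
          · rintro _ rfl
            exact absurd hm (hXM _ p1)
        · refine ⟨fun _ h => absurd p1 (hXW _ h), by simp, fun _ _ => ⟨h1, i2 rfl p1⟩, ?_⟩
          rintro _ rfl
          exact absurd p1 (hMW _ hm)
        · exact ⟨by simp, fun _ _ => ⟨c1, p3, p5, i1 rfl p3⟩, by simp, by simp⟩
        · refine ⟨fun _ h => absurd p1 (hXM _ h), by simp, fun _ h => absurd h (hMW _ p1), ?_⟩
          rintro _ rfl
          exact (hAdj _ _ p5 p3 (Or.inl rfl)).reachable.trans (i1 rfl p3)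
    exact (main (m, false) (hA3 ⟨m, hm⟩)).2.2.2 rfl rfl

lemma imm_add {V : Type*} [Fintype V] {G : SimpleGraph V} {Y X : Finset V} {t : ℕ} (u : V)
    (hu : u ∈ X) (hXY : X ⊆ Y) (hdom : ∀ y ∈ Y \ X, ∃ x ∈ X, G.Adj y x)
    (hmix : ∀ X' ⊆ X, u ∈ X' → X' ≠ X → t ≤ ((Y \ X).filter
      (fun y => (∃ x ∈ X', G.Adj y x) ∧ ∃ x ∈ X, x ∉ X' ∧ G.Adj y x)).card)
    (h : ImmX G (Y \ X) t) : ImmX G Y (t + 1) := by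
  refine imm_extend (N := {u}) h Finset.sdiff_subset (by simpa using hXY hu) (by simp [hu]) (by simp) ?_
  intro M hM hMt
  have hMX : ∀ m ∈ M, m ∉ X := fun m hm => (Finset.mem_sdiff.mp (hM hm)).2
  have hun : M ∪ ((Y \ X) \ M) = Y \ X := Finset.union_sdiff_of_subset hM
  obtain ⟨B, hB1, hB2, hB3⟩ := route G X M ((Y \ X) \ M) u hu (fun x hx hm => hMX x hm hx)
    (by intro x hx; simp [hx]) (by intro x hx; simp [hx]) (fun m hm => hdom m (hM hm))
    (by rw [hun, hMt]; exact hmix)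
  refine ⟨fun p => SimpleGraph.fromRel fun a b => G.Adj a b ∧ b ∈ X ∧ ∃ m ∈ M, p = s(m, u) ∧
        (a = m ∨ a ∈ B m), ?_, ?_⟩
  · intro a ha b hb hab
    obtain rfl := Finset.mem_singleton.mp hb
    have ha' : a ∈ M := by
      simp only [Finset.mem_union, Finset.mem_singleton] at ha; tauto
    refine ⟨?_, ?_⟩
    · intro x y hxy
      rw [SimpleGraph.fromRel_adj] at hxy
      have aux : ∀ x y, (G.Adj x y ∧ y ∈ X ∧ ∃ m ∈ M, s(a, b) = s(m, b) ∧ (x = m ∨ x ∈ B m)) →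
          G.Adj x y ∧ x ∈ Y ∧ y ∈ Y ∧ y ∉ Y \ X := by
        rintro x y ⟨h1, h2, m, hm, -, h3⟩
        refine ⟨h1, ?_, hXY h2, by simp [h2]⟩
        rcases h3 with rfl | h3
        · exact (Finset.mem_sdiff.mp (hM hm)).1
        · exact (Finset.mem_sdiff.mp (Finset.mem_sdiff.mp (hB1 _ h3)).1).1
      rcases hxy.2 with h | h
      · have := aux _ _ h; tauto
      · have := aux _ _ h; have := h.1.symm; tauto
    · refine (hB3 a ha').mono ?_
      intro x y hxy
      rw [SimpleGraph.fromRel_adj] at hxy ⊢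
      refine ⟨hxy.1, ?_⟩
      rcases hxy.2 with h | h
      · exact Or.inl ⟨h.1, h.2.1, a, ha', rfl, h.2.2⟩
      · exact Or.inr ⟨h.1, h.2.1, a, ha', rfl, h.2.2⟩
  · intro a ha b hb c hc d hd hab hcd hne x y h1 h2
    obtain rfl := Finset.mem_singleton.mp hb
    obtain rfl := Finset.mem_singleton.mp hd
    rw [SimpleGraph.fromRel_adj] at h1 h2
    have aux : ∀ x y, (G.Adj x y ∧ y ∈ X ∧ ∃ m ∈ M, s(a, d) = s(m, d) ∧ (x = m ∨ x ∈ B m)) →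
        (G.Adj x y ∧ y ∈ X ∧ ∃ m ∈ M, s(c, d) = s(m, d) ∧ (x = m ∨ x ∈ B m)) → False := by
      rintro x y ⟨-, -, m, hm, e1, h1⟩ ⟨-, -, m', hm', e2, h2⟩
      have hmm : m ≠ m' := by rintro rfl; exact hne (e1.trans e2.symm)
      have nB : ∀ m ∈ M, ∀ m', m ∉ B m' := fun m hm m' hb => (Finset.mem_sdiff.mp (hB1 _ hb)).2 hm
      rcases h1 with rfl | h1 <;> rcases h2 with rfl | h2
      · exact hmm rfl
      · exact nB _ hm _ h2
      · exact nB _ hm' _ h1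
      · exact Finset.disjoint_left.mp (hB2 m hm m' hm' hmm) h1 h2
    have nX : ∀ x y p, (G.Adj x y ∧ y ∈ X ∧ ∃ m ∈ M, p = s(m, d) ∧ (x = m ∨ x ∈ B m)) → x ∉ X := by
      rintro x y p ⟨-, -, m, hm, -, h3⟩
      rcases h3 with rfl | h3
      · exact hMX _ hm
      · exact (Finset.mem_sdiff.mp (Finset.mem_sdiff.mp (hB1 _ h3)).1).2
    rcases h1.2 with h1 | h1 <;> rcases h2.2 with h2 | h2
    · exact aux _ _ h1 h2
    · exact nX _ _ _ h1 h2.2.1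
    · exact nX _ _ _ h1 h2.2.1
    · exact aux _ _ h1 h2


def IsC5 {V : Type*} (G : SimpleGraph V) (p v q r u : V) : Prop :=
  (G.Adj p v ∧ G.Adj v q ∧ G.Adj q r ∧ G.Adj r u ∧ G.Adj u p) ∧
  (¬ G.Adj p q ∧ ¬ G.Adj p r ∧ ¬ G.Adj v r ∧ ¬ G.Adj v u ∧ ¬ G.Adj q u) ∧
  (p ≠ q ∧ p ≠ r ∧ v ≠ r ∧ v ≠ u ∧ q ≠ u)

def A2 {V : Type*} (G : SimpleGraph V) (Y : Finset V) : Prop :=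
  ∀ a ∈ Y, ∀ b ∈ Y, ∀ c ∈ Y, a ≠ b → a ≠ c → b ≠ c → G.Adj a b ∨ G.Adj a c ∨ G.Adj b c

lemma IsC5.rot {V : Type*} {G : SimpleGraph V} {p v q r u : V} (h : IsC5 G p v q r u) :
    IsC5 G v q r u p := by
  obtain ⟨⟨h1, h2, h3, h4, h5⟩, ⟨n1, n2, n3, n4, n5⟩, ⟨e1, e2, e3, e4, e5⟩⟩ := h
  refine ⟨⟨h2, h3, h4, h5, h1⟩, ⟨n3, n4, n5, fun h => n1 h.symm, fun h => n2 h.symm⟩,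
    ⟨e3, e4, e5, e1.symm, e2.symm⟩⟩

lemma c5_build {V : Type*} {G : SimpleGraph V} {Y : Finset V} {s : ℕ} {p v q r u : V}
    (hc : IsC5 G p v q r u) (hp : p ∈ Y) (hv : v ∈ Y) (hq : q ∈ Y) (hr : r ∈ Y) (hu : u ∈ Y)
    (h2 : A2 G Y) (h : ImmX G (Y \ {p, v, q, r, u}) s)
    (hg : ∀ M ⊆ Y \ {p, v, q, r, u}, M.card = s → ∃ g z : V → V,
      (∀ m ∈ M, ∀ m' ∈ M, (¬ G.Adj m u ∨ ¬ G.Adj m v) → (¬ G.Adj m' u ∨ ¬ G.Adj m' v) →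
        g m = g m' → m = m') ∧
      (∀ m ∈ M, (¬ G.Adj m u ∨ ¬ G.Adj m v) → g m ∈ Y \ {p, v, q, r, u} ∧ g m ∉ M ∧
        (z m = p ∨ z m = q ∨ z m = r) ∧ G.Adj m (z m) ∧ G.Adj (g m) (z m) ∧
        (¬ G.Adj m u → G.Adj (g m) u) ∧ (¬ G.Adj m v → G.Adj (g m) v))) :
    ImmX G Y (s + 2) := by
  obtain ⟨⟨h1', h2', h3', h4', h5'⟩, ⟨n1, n2, n3, n4, n5⟩, ⟨e1, e2, e3, e4, e5⟩⟩ := hc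
  refine imm_extend (N := {u, v}) h Finset.sdiff_subset ?_ ?_ (Finset.card_pair e4.symm) ?_
  · intro x hx
    simp only [Finset.mem_insert, Finset.mem_singleton] at hx
    rcases hx with rfl | rfl <;> assumption
  · rw [Finset.disjoint_right]
    intro x hx
    simp only [Finset.mem_insert, Finset.mem_singleton] at hx
    rcases hx with rfl | rfl <;> simp
  intro M hM hMs
  obtain ⟨g, z, hginj, hgz⟩ := hg M hM hMs
  have hMY : ∀ m ∈ M, m ∈ Y ∧ m ≠ p ∧ m ≠ v ∧ m ≠ q ∧ m ≠ r ∧ m ≠ u := by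
    intro m hm
    have := hM hm
    simp only [Finset.mem_sdiff, Finset.mem_insert, Finset.mem_singleton, not_or] at this
    tauto
  have hgY : ∀ m ∈ M, (¬ G.Adj m u ∨ ¬ G.Adj m v) → g m ∈ Y ∧ g m ≠ p ∧ g m ≠ v ∧ g m ≠ q ∧
      g m ≠ r ∧ g m ≠ u := by
    intro m hm hb
    have := (hgz m hm hb).1
    simp only [Finset.mem_sdiff, Finset.mem_insert, Finset.mem_singleton, not_or] at this
    tauto
  have hbad : ∀ m ∈ M, ¬ G.Adj m u → ¬ G.Adj m v → False := by
    intro m hm k1 k2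
    have k := hMY m hm
    have := h2 m k.1 u hu v hv k.2.2.2.2.2 k.2.2.1 e4.symm
    have k3 : ¬ G.Adj u v := fun h => n4 h.symm
    tauto
  -- T2 edges
  let T2 : V → V → V → V → Prop := fun m a x y =>
    (G.Adj m a ∧ x = m ∧ y = a) ∨ (¬ G.Adj m a ∧ ((x = m ∧ y = z m) ∨ (x = g m ∧ y = z m) ∨
      (x = g m ∧ y = a)))
  let RR : Sym2 V → V → V → Prop := fun e x y =>
    (e = s(u, v) ∧ ((x = u ∧ y = p) ∨ (x = p ∧ y = v))) ∨
    ∃ m ∈ M, ∃ a, (a = u ∨ a = v) ∧ e = s(m, a) ∧ T2 m a x y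
  have T2prop : ∀ m ∈ M, ∀ a, (a = u ∨ a = v) → ∀ x y, T2 m a x y →
      G.Adj x y ∧ (x ∈ Y ∧ x ≠ p ∧ x ≠ v ∧ x ≠ q ∧ x ≠ r ∧ x ≠ u) ∧
      (y = p ∨ y = v ∨ y = q ∨ y = r ∨ y = u) := by
    intro m hm a ha x y hT
    rcases hT with ⟨k1, rfl, rfl⟩ | ⟨k1, hT⟩
    · exact ⟨k1, hMY _ hm, ha.elim (fun h => Or.inr (Or.inr (Or.inr (Or.inr h)))) (fun h => Or.inr (Or.inl h))⟩
    · have hb : (¬ G.Adj m u ∨ ¬ G.Adj m v) := by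
        rcases ha with rfl | rfl
        · exact Or.inl k1
        · exact Or.inr k1
      obtain ⟨g1, g2, g3, g4, g5, g6, g7⟩ := hgz m hm hb
      rcases hT with ⟨rfl, rfl⟩ | ⟨rfl, rfl⟩ | ⟨rfl, rfl⟩
      · exact ⟨g4, hMY _ hm, g3.elim Or.inl (fun h => h.elim (fun h => Or.inr (Or.inr (Or.inl h))) (fun h => Or.inr (Or.inr (Or.inr (Or.inl h)))))⟩
      · exact ⟨g5, hgY _ hm hb, g3.elim Or.inl (fun h => h.elim (fun h => Or.inr (Or.inr (Or.inl h))) (fun h => Or.inr (Or.inr (Or.inr (Or.inl h)))))⟩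
      · refine ⟨?_, hgY _ hm hb, ha.elim (fun h => Or.inr (Or.inr (Or.inr (Or.inr h)))) (fun h => Or.inr (Or.inl h))⟩
        rcases ha with rfl | rfl
        · exact g6 k1
        · exact g7 k1
  have T2disj : ∀ m ∈ M, ∀ a, (a = u ∨ a = v) → ∀ m' ∈ M, ∀ a', (a' = u ∨ a' = v) →
      s(m, a) ≠ s(m', a') → ∀ x y, T2 m a x y → T2 m' a' x y → False := by
    intro m hm a ha m' hm' a' ha' hne x y hT hT'
    have bad : ∀ m a, (a = u ∨ a = v) → ¬ G.Adj m a → (¬ G.Adj m u ∨ ¬ G.Adj m v) := by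
      intro m a ha hh
      rcases ha with rfl | rfl
      · exact Or.inl hh
      · exact Or.inr hh
    have hx : ∀ m ∈ M, ∀ a, (a = u ∨ a = v) → T2 m a x y → x = m ∨
        (x = g m ∧ x ∉ M ∧ (¬ G.Adj m u ∨ ¬ G.Adj m v)) := by
      rintro m hm a ha (⟨k1, k2, k3⟩ | ⟨k1, k2⟩)
      · exact Or.inl k2
      · have hb := bad m a ha k1
        have := (hgz m hm hb).2.1
        rcases k2 with ⟨rfl, rfl⟩ | ⟨rfl, rfl⟩ | ⟨rfl, rfl⟩
        · exact Or.inl rfl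
        · exact Or.inr ⟨rfl, this, hb⟩
        · exact Or.inr ⟨rfl, this, hb⟩
    have hmm : m = m' := by
      rcases hx m hm a ha hT with k | ⟨k1, k2, k3⟩ <;>
      rcases hx m' hm' a' ha' hT' with l | ⟨l1, l2, l3⟩
      · exact k.symm.trans l
      · exact absurd (k ▸ hm) l2
      · exact absurd (l ▸ hm') k2
      · exact hginj m hm m' hm' k3 l3 (k1.symm.trans l1)
    subst hmm
    have haa : a ≠ a' := by rintro rfl; exact hne rfl
    have hza : ∀ a, (a = u ∨ a = v) → ¬ G.Adj m a → z m ≠ u ∧ z m ≠ v := by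
      intro a ha k
      have := (hgz m hm (bad m a ha k)).2.2.1
      have w1 := h1'.ne
      have w2 := h2'.ne
      have w3 := h4'.ne
      have w4 := h5'.ne
      rcases this with h | h | h <;> rw [h] <;> constructor <;> first | assumption | (apply Ne.symm; assumption)
    have hgm : ∀ a, (a = u ∨ a = v) → ¬ G.Adj m a → g m ≠ m := by
      intro a ha k h
      exact (hgz m hm (bad m a ha k)).2.1 (h.symm.subst (motive := fun w => w ∈ M) hm)
    have h2bad : ¬ G.Adj m a → ¬ G.Adj m a' → False := by
      intro k1 k2
      rcases ha with rfl | rfl <;> rcases ha' with rfl | rfl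
      · exact haa rfl
      · exact hbad m hm k1 k2
      · exact hbad m hm k2 k1
      · exact haa rfl
    rcases hT with ⟨k1, k2, k3⟩ | ⟨k1, k2⟩ <;> rcases hT' with ⟨l1, l2, l3⟩ | ⟨l1, l2⟩
    · exact haa (k3.symm.trans l3)
    · have q1 := hza a' ha' l1
      have q2 := hgm a' ha' l1
      rcases l2 with ⟨l2, l3⟩ | ⟨l2, l3⟩ | ⟨l2, l3⟩
      · rcases ha with rfl | rfl
        · exact q1.1 (l3.symm.trans k3)
        · exact q1.2 (l3.symm.trans k3)
      · exact q2 (l2.symm.trans k2)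
      · exact q2 (l2.symm.trans k2)
    · have q1 := hza a ha k1
      have q2 := hgm a ha k1
      rcases k2 with ⟨k2, k3⟩ | ⟨k2, k3⟩ | ⟨k2, k3⟩
      · rcases ha' with rfl | rfl
        · exact q1.1 (k3.symm.trans l3)
        · exact q1.2 (k3.symm.trans l3)
      · exact q2 (k2.symm.trans l2)
      · exact q2 (k2.symm.trans l2)
    · exact h2bad k1 l1
  have RRadj : ∀ e x y, RR e x y → G.Adj x y ∧ x ∈ Y ∧ y ∈ Y ∧ y ∉ Y \ {p, v, q, r, u} := by
    rintro e x y (⟨-, ⟨rfl, rfl⟩ | ⟨rfl, rfl⟩⟩ | ⟨m, hm, a, ha, -, hT⟩)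
    · exact ⟨h5', hu, hp, by simp⟩
    · exact ⟨h1', hp, hv, by simp⟩
    · obtain ⟨k1, k2, k3⟩ := T2prop m hm a ha x y hT
      refine ⟨k1, k2.1, ?_, by simp [k3]⟩
      rcases k3 with rfl | rfl | rfl | rfl | rfl <;> assumption
  refine ⟨fun e => SimpleGraph.fromRel (RR e), ?_, ?_⟩
  · intro a ha b hb hab
    refine ⟨?_, ?_⟩
    · intro x y hxy
      rw [SimpleGraph.fromRel_adj] at hxy
      rcases hxy.2 with h | h
      · have := RRadj _ _ _ h; clear_value RR T2; clear T2disj T2prop RRadj hgY hMY hginj hgz hbad; tauto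
      · have := RRadj _ _ _ h; have := this.1.symm; clear_value RR T2; clear T2disj T2prop RRadj hgY hMY hginj hgz hbad; tauto
    · have mk : ∀ e x y, RR e x y → (SimpleGraph.fromRel (RR e)).Reachable x y := by
        intro e x y hR
        refine SimpleGraph.Adj.reachable ?_
        rw [SimpleGraph.fromRel_adj]
        exact ⟨(RRadj _ _ _ hR).1.ne, Or.inl hR⟩
      simp only [Finset.mem_union, Finset.mem_insert, Finset.mem_singleton] at ha hb
      have huv : (SimpleGraph.fromRel (RR s(u, v))).Reachable u v :=
        (mk s(u, v) u p (Or.inl ⟨rfl, Or.inl ⟨rfl, rfl⟩⟩)).trans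
          (mk s(u, v) p v (Or.inl ⟨rfl, Or.inr ⟨rfl, rfl⟩⟩))
      rcases ha with ha | ha
      · by_cases k : G.Adj a b
        · exact mk _ _ _ (Or.inr ⟨a, ha, b, hb, rfl, Or.inl ⟨k, rfl, rfl⟩⟩)
        · have t1 := mk s(a, b) a (z a) (Or.inr ⟨a, ha, b, hb, rfl, Or.inr ⟨k, Or.inl ⟨rfl, rfl⟩⟩⟩)
          have t2 := mk s(a, b) (g a) (z a) (Or.inr ⟨a, ha, b, hb, rfl, Or.inr ⟨k, Or.inr (Or.inl ⟨rfl, rfl⟩)⟩⟩)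
          have t3 := mk s(a, b) (g a) b (Or.inr ⟨a, ha, b, hb, rfl, Or.inr ⟨k, Or.inr (Or.inr ⟨rfl, rfl⟩)⟩⟩)
          exact (t1.trans t2.symm).trans t3
      · rcases ha with rfl | rfl <;> rcases hb with rfl | rfl
        · exact absurd rfl hab
        · exact huv
        · rw [Sym2.eq_swap]; exact huv.symm
        · exact absurd rfl hab
  · intro a ha b hb c hc d hd hab hcd hne x y k1 k2
    rw [SimpleGraph.fromRel_adj] at k1 k2
    have w1 := h1'.ne
    have w5 := h5'.ne
    have big : ∀ {x y : V}, ((x = u ∧ y = p) ∨ (x = p ∧ y = v)) →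
        (x ∈ Y ∧ x ≠ p ∧ x ≠ v ∧ x ≠ q ∧ x ≠ r ∧ x ≠ u) → False := by
      intro x y k l
      rcases k with k | k
      · exact l.2.2.2.2.2 k.1
      · exact l.2.1 k.1
    have bigo : ∀ {x y : V}, ((x = u ∧ y = p) ∨ (x = p ∧ y = v)) →
        (y ∈ Y ∧ y ≠ p ∧ y ≠ v ∧ y ≠ q ∧ y ≠ r ∧ y ≠ u) → False := by
      intro x y k l
      rcases k with k | k
      · exact l.2.1 k.2
      · exact l.2.2.1 k.2
    have same : ∀ x y, RR s(a, b) x y → RR s(c, d) x y → False := by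
      rintro x y (⟨E1, k1⟩ | ⟨m, hm, a', ha', E1, hT⟩) (⟨E2, k2⟩ | ⟨m2, hm2, a2, ha2, E2, hT2⟩)
      · exact hne (E1.trans E2.symm)
      · exact big k1 (T2prop _ hm2 _ ha2 _ _ hT2).2.1
      · exact big k2 (T2prop _ hm _ ha' _ _ hT).2.1
      · exact T2disj m hm a' ha' m2 hm2 a2 ha2 (by rw [← E1, ← E2]; exact hne) x y hT hT2
    have opp : ∀ x y, RR s(a, b) x y → RR s(c, d) y x → False := by
      rintro x y (⟨E1, k1⟩ | ⟨m, hm, a', ha', E1, hT⟩) (⟨E2, k2⟩ | ⟨m2, hm2, a2, ha2, E2, hT2⟩)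
      · exact hne (E1.trans E2.symm)
      · exact bigo k1 (T2prop _ hm2 _ ha2 _ _ hT2).2.1
      · exact bigo k2 (T2prop _ hm _ ha' _ _ hT).2.1
      · have t1 := (T2prop _ hm2 _ ha2 _ _ hT2).2.1
        have t2 := (T2prop _ hm _ ha' _ _ hT).2.2
        obtain ⟨-, a1, a2, a3, a4, a5⟩ := t1
        rcases t2 with t | t | t | t | t
        · exact a1 t
        · exact a2 t
        · exact a3 t
        · exact a4 t
        · exact a5 t
    rcases k1.2 with k1 | k1 <;> rcases k2.2 with k2 | k2
    · exact same _ _ k1 k2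
    · exact opp _ _ k1 k2
    · exact opp _ _ k1 k2
    · exact same _ _ k1 k2

lemma c5_step {V : Type*} {G : SimpleGraph V} {Y : Finset V} {s : ℕ} {p v q r u : V}
    (hc : IsC5 G p v q r u) (hp : p ∈ Y) (hv : v ∈ Y) (hq : q ∈ Y) (hr : r ∈ Y) (hu : u ∈ Y)
    (h2 : A2 G Y)
    (hcl : ∀ C ⊆ Y, (∀ x ∈ C, ∀ y ∈ C, x ≠ y → G.Adj x y) → C.card < s + 2)
    (hcard : 5 * s ≤ 2 * (Y \ {p, v, q, r, u}).card)
    (hQR : 5 * ((Y \ {p, v, q, r, u}).filter fun y => ¬ G.Adj y q ∧ ¬ G.Adj y r).card ≤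
      (Y \ {p, v, q, r, u}).card)
    (h : ImmX G (Y \ {p, v, q, r, u}) s) : ImmX G Y (s + 2) := by
  refine c5_build hc hp hv hq hr hu h2 h ?_
  obtain ⟨⟨h1', h2', h3', h4', h5'⟩, ⟨n1, n2, n3, n4, n5⟩, ⟨e1, e2, e3, e4, e5⟩⟩ := hc
  intro M hM hMs
  set R := Y \ {p, v, q, r, u} with hR
  have hRY : ∀ m ∈ R, m ∈ Y ∧ m ≠ p ∧ m ≠ v ∧ m ≠ q ∧ m ≠ r ∧ m ≠ u := by
    intro m hm
    simp only [hR, Finset.mem_sdiff, Finset.mem_insert, Finset.mem_singleton, not_or] at hm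
    tauto
  -- two nonadjacent vertices dominate
  have dom : ∀ y ∈ R, ∀ a ∈ Y, ∀ b ∈ Y, y ≠ a → y ≠ b → a ≠ b → ¬ G.Adj a b →
      ¬ G.Adj y a → G.Adj y b := by
    intro y hy a ha b hb k1 k2 k3 k4 k5
    have := h2 y (hRY y hy).1 a ha b hb k1 k2 k3
    tauto
  have domuv : ∀ y ∈ R, ¬ G.Adj y u → G.Adj y v := fun y hy =>
    have k := hRY y hy
    dom y hy u hu v hv k.2.2.2.2.2 k.2.2.1 e4.symm (fun h => n4 h.symm)
  set W := (R \ M).filter fun y => ¬ (¬ G.Adj y q ∧ ¬ G.Adj y r) with hW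
  have Wtot : s ≤ W.card := by
    have : R ⊆ W ∪ M ∪ (R.filter fun y => ¬ G.Adj y q ∧ ¬ G.Adj y r) := by
      intro y hy
      simp only [hW, Finset.mem_union, Finset.mem_filter, Finset.mem_sdiff]
      tauto
    have c1 := Finset.card_le_card this
    have c2 := Finset.card_union_le (W ∪ M) (R.filter fun y => ¬ G.Adj y q ∧ ¬ G.Adj y r)
    have c3 := Finset.card_union_le W M
    omega
  have Wa : ∀ a ∈ Y, ∀ b ∈ Y, ∀ c ∈ Y, (a = u ∨ a = v) → b ∉ R → c ∉ R → a ∉ R → a ≠ b → a ≠ c →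
      ¬ G.Adj b a → ¬ G.Adj c a → G.Adj b c →
      (M.filter fun m => ¬ G.Adj m a).card ≤ (W.filter fun w => G.Adj w a).card := by
    intro a ha b hb c hc hauv hbR hcR haR hab hac nab nac hbc
    have c0 := hcl (insert b (insert c (R.filter fun y => ¬ G.Adj y a))) (by
        intro y hy
        simp only [Finset.mem_insert, Finset.mem_filter] at hy
        rcases hy with rfl | rfl | hy
        · exact hb
        · exact hc
        · exact (hRY y hy.1).1) (by
        have gen : ∀ x y, x ∈ Y → y ∈ Y → x ≠ a → y ≠ a → ¬ G.Adj x a → ¬ G.Adj y a → x ≠ y →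
            G.Adj x y := by
          intro x y hx hy k1 k2 k3 k4 k5
          have := h2 x hx y hy a ha k5 k1 k2
          tauto
        have mem : ∀ x ∈ insert b (insert c (R.filter fun y => ¬ G.Adj y a)),
            x ∈ Y ∧ x ≠ a ∧ ¬ G.Adj x a := by
          intro y hy
          simp only [Finset.mem_insert, Finset.mem_filter] at hy
          rcases hy with rfl | rfl | hy
          · exact ⟨hb, hab.symm, nab⟩
          · exact ⟨hc, hac.symm, nac⟩
          · exact ⟨(hRY y hy.1).1, fun h => haR (h ▸ hy.1), hy.2⟩
        intro x hx y hy hxy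
        have k1 := mem x hx
        have k2 := mem y hy
        exact gen x y k1.1 k2.1 k1.2.1 k2.2.1 k1.2.2 k2.2.2 hxy)
    rw [Finset.card_insert_of_notMem (by simp [hbc.ne, hbR]),
      Finset.card_insert_of_notMem (by simp [hcR])] at c0
    have : R ⊆ (W.filter fun w => G.Adj w a) ∪ (M.filter fun m => G.Adj m a) ∪
        (R.filter fun y => ¬ G.Adj y q ∧ ¬ G.Adj y r) ∪ (R.filter fun y => ¬ G.Adj y a) := by
      intro y hy
      simp only [hW, Finset.mem_union, Finset.mem_filter, Finset.mem_sdiff]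
      tauto
    have c1 := Finset.card_le_card this
    have c2 := Finset.card_union_le ((W.filter fun w => G.Adj w a) ∪ (M.filter fun m => G.Adj m a) ∪
        (R.filter fun y => ¬ G.Adj y q ∧ ¬ G.Adj y r)) (R.filter fun y => ¬ G.Adj y a)
    have c3 := Finset.card_union_le ((W.filter fun w => G.Adj w a) ∪ (M.filter fun m => G.Adj m a))
        (R.filter fun y => ¬ G.Adj y q ∧ ¬ G.Adj y r)
    have c4 := Finset.card_union_le (W.filter fun w => G.Adj w a) (M.filter fun m => G.Adj m a)
    have c5 := Finset.card_filter_add_card_filter_not (s := M) (fun m => G.Adj m a)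
    omega
  have notR : p ∉ R ∧ v ∉ R ∧ q ∉ R ∧ r ∉ R ∧ u ∉ R := by simp [hR]
  have Wu := Wa u hu v hv q hq (Or.inl rfl) notR.2.1 notR.2.2.1 notR.2.2.2.2 e4.symm e5.symm n4 n5 h2'
  have Wv := Wa v hv u hu r hr (Or.inr rfl) notR.2.2.2.2 notR.2.2.2.1 notR.2.1 e4 e3
    (fun h => n4 h.symm) (fun h => n3 h.symm) h4'.symm
  let Bad := M.filter fun m => ¬ G.Adj m u ∨ ¬ G.Adj m v
  let L : {m // m ∈ Bad} → Finset V := fun m =>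
    W.filter fun w => (¬ G.Adj m.1 u → G.Adj w u) ∧ (¬ G.Adj m.1 v → G.Adj w v)
  have hBad : ∀ m : {m // m ∈ Bad}, m.1 ∈ M ∧ (¬ G.Adj m.1 u ∨ ¬ G.Adj m.1 v) :=
    fun m => Finset.mem_filter.mp m.2
  have hall : ∀ S : Finset {m // m ∈ Bad}, S.card ≤ (S.biUnion L).card := by
    intro S
    rcases S.eq_empty_or_nonempty with rfl | ⟨m0, hm0⟩
    · simp
    have hS : S.card = (S.map (Function.Embedding.subtype _)).card := (Finset.card_map _).symm
    by_cases k1 : ∀ m ∈ S, ¬ G.Adj m.1 u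
    · have : S.card ≤ (M.filter fun m => ¬ G.Adj m u).card := by
        rw [hS]
        refine Finset.card_le_card fun x hx => ?_
        obtain ⟨m, hm, rfl⟩ := Finset.mem_map.mp hx
        exact Finset.mem_filter.mpr ⟨(hBad m).1, k1 m hm⟩
      refine this.trans (Wu.trans (Finset.card_le_card ?_))
      intro w hw
      rw [Finset.mem_filter] at hw
      refine Finset.mem_biUnion.mpr ⟨m0, hm0, Finset.mem_filter.mpr ⟨hw.1, fun _ => hw.2, fun h => ?_⟩⟩
      exact absurd (domuv _ (hM (hBad m0).1) (k1 m0 hm0)) h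
    by_cases k2 : ∀ m ∈ S, ¬ G.Adj m.1 v
    · have : S.card ≤ (M.filter fun m => ¬ G.Adj m v).card := by
        rw [hS]
        refine Finset.card_le_card fun x hx => ?_
        obtain ⟨m, hm, rfl⟩ := Finset.mem_map.mp hx
        exact Finset.mem_filter.mpr ⟨(hBad m).1, k2 m hm⟩
      refine this.trans (Wv.trans (Finset.card_le_card ?_))
      intro w hw
      rw [Finset.mem_filter] at hw
      refine Finset.mem_biUnion.mpr ⟨m0, hm0, Finset.mem_filter.mpr ⟨hw.1, fun h => ?_, fun _ => hw.2⟩⟩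
      exact absurd (domuv _ (hM (hBad m0).1) h) (k2 m0 hm0)
    push Not at k1 k2
    obtain ⟨m1, hm1, k1⟩ := k1
    obtain ⟨m2, hm2, k2⟩ := k2
    have : S.card ≤ M.card := by
      rw [hS]
      refine Finset.card_le_card fun x hx => ?_
      obtain ⟨m, hm, rfl⟩ := Finset.mem_map.mp hx
      exact (hBad m).1
    refine (this.trans (hMs.le.trans Wtot)).trans (Finset.card_le_card ?_)
    intro w hw
    have hwR : w ∈ R := by
      simp only [hW, Finset.mem_filter, Finset.mem_sdiff] at hw; exact hw.1.1
    by_cases kw : G.Adj w u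
    · exact Finset.mem_biUnion.mpr ⟨m2, hm2, Finset.mem_filter.mpr ⟨hw, fun _ => kw, fun h => absurd k2 h⟩⟩
    · exact Finset.mem_biUnion.mpr ⟨m1, hm1, Finset.mem_filter.mpr ⟨hw, fun h => absurd k1 h, fun _ => domuv w hwR kw⟩⟩
  obtain ⟨f, hf1, hf2⟩ := (Finset.all_card_le_biUnion_card_iff_exists_injective L).mp hall
  have hz : ∀ m : {m // m ∈ Bad}, ∃ z, (z = p ∨ z = q ∨ z = r) ∧ G.Adj m.1 z ∧ G.Adj (f m) z := by
    intro m
    have hm := hBad m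
    have hmR := hM hm.1
    have k := hRY _ hmR
    have hw := Finset.mem_filter.mp (hf2 m)
    have hw1 := hw.1
    simp only [hW, Finset.mem_filter, Finset.mem_sdiff] at hw1
    obtain ⟨⟨hwR, -⟩, hwqr⟩ := hw1
    have kw := hRY _ hwR
    have nqp : ¬ G.Adj q p := fun h => n1 h.symm
    have nrp : ¬ G.Adj r p := fun h => n2 h.symm
    have wpq := dom _ hwR q hq p hp kw.2.2.2.1 kw.2.1 e1.symm nqp
    have wpr := dom _ hwR r hr p hp kw.2.2.2.2.1 kw.2.1 e2.symm nrp
    have mpq := dom _ hmR q hq p hp k.2.2.2.1 k.2.1 e1.symm nqp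
    have mpr := dom _ hmR r hr p hp k.2.2.2.2.1 k.2.1 e2.symm nrp
    have muq := dom _ hmR u hu q hq k.2.2.2.2.2 k.2.2.2.1 e5.symm (fun h => n5 h.symm)
    have mvr := dom _ hmR v hv r hr k.2.2.1 k.2.2.2.2.1 e3 n3
    rcases hm.2 with hb | hb
    · by_cases c1 : G.Adj (f m) q
      · exact ⟨q, Or.inr (Or.inl rfl), muq hb, c1⟩
      · by_cases c2 : G.Adj m.1 r
        · exact ⟨r, Or.inr (Or.inr rfl), c2, by_contra fun c3 => hwqr ⟨c1, c3⟩⟩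
        · exact ⟨p, Or.inl rfl, mpr c2, wpq c1⟩
    · by_cases c1 : G.Adj (f m) r
      · exact ⟨r, Or.inr (Or.inr rfl), mvr hb, c1⟩
      · by_cases c2 : G.Adj m.1 q
        · exact ⟨q, Or.inr (Or.inl rfl), c2, by_contra fun c3 => hwqr ⟨c3, c1⟩⟩
        · exact ⟨p, Or.inl rfl, mpq c2, wpr c1⟩
  choose z hz using hz
  refine ⟨fun m => if hm : m ∈ Bad then f ⟨m, hm⟩ else m, fun m => if hm : m ∈ Bad then z ⟨m, hm⟩ else m, ?_, ?_⟩
  · intro m hm m' hm' hb hb' he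
    have b1 : m ∈ Bad := Finset.mem_filter.mpr ⟨hm, hb⟩
    have b2 : m' ∈ Bad := Finset.mem_filter.mpr ⟨hm', hb'⟩
    simp only [b1, b2, dif_pos] at he
    simpa using hf1 he
  · intro m hm hb
    have b1 : m ∈ Bad := Finset.mem_filter.mpr ⟨hm, hb⟩
    simp only [b1, dif_pos]
    have hw := Finset.mem_filter.mp (hf2 ⟨m, b1⟩)
    have hw1 := hw.1
    simp only [hW, Finset.mem_filter, Finset.mem_sdiff] at hw1
    have := hz ⟨m, b1⟩
    exact ⟨hw1.1.1, hw1.1.2, this.1, this.2.1, this.2.2, hw.2.1, hw.2.2⟩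


lemma seven_sum (b0 b1 b2 b3 b4 b5 b6 : ℕ)
    (a0 : b0 + b1 ≤ 1) (a1 : b1 + b2 ≤ 1) (a2 : b2 + b3 ≤ 1) (a3 : b3 + b4 ≤ 1)
    (a4 : b4 + b5 ≤ 1) (a5 : b5 + b6 ≤ 1) (a6 : b6 + b0 ≤ 1)
    (c0 : b0 + b3 ≤ 1) (c1 : b1 + b4 ≤ 1) (c2 : b2 + b5 ≤ 1) (c3 : b3 + b6 ≤ 1)
    (c4 : b4 + b0 ≤ 1) (c5 : b5 + b1 ≤ 1) (c6 : b6 + b2 ≤ 1) :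
    b0 + b1 + b2 + b3 + b4 + b5 + b6 ≤ 2 := by
  have t0 : b0 + b1 + b4 ≤ 1 := by omega
  have t1 : b1 + b2 + b5 ≤ 1 := by omega
  have t2 : b2 + b3 + b6 ≤ 1 := by omega
  have t3 : b3 + b4 + b0 ≤ 1 := by omega
  have t4 : b4 + b5 + b1 ≤ 1 := by omega
  have t5 : b5 + b6 + b2 ≤ 1 := by omega
  have t6 : b6 + b0 + b3 ≤ 1 := by omega
  omega

lemma p2_struct {V : Type*} {G : SimpleGraph V} {Y : Finset V} {t : ℕ}
    (h2 : A2 G Y) (hn : 5 * t ≤ 2 * Y.card)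
    (hdeg : ∀ x ∈ Y, ∀ y ∈ Y, x ≠ y → ¬ G.Adj x y →
      ((Y \ {x, y}).filter fun w => G.Adj w x ∧ G.Adj w y).card + 2 ≤ t)
    (hc5 : ∀ p ∈ Y, ∀ v ∈ Y, ∀ q ∈ Y, ∀ r ∈ Y, ∀ u ∈ Y, ¬ IsC5 G p v q r u) :
    ∃ C ⊆ Y, (∀ x ∈ C, ∀ y ∈ C, x ≠ y → G.Adj x y) ∧ t ≤ C.card := by
  let H : V → V → Prop := fun x y => x ∈ Y ∧ y ∈ Y ∧ x ≠ y ∧ ¬ G.Adj x y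
  have Hs : ∀ {x y}, H x y → H y x := fun h => ⟨h.2.1, h.1, h.2.2.1.symm, fun k => h.2.2.2 k.symm⟩
  have tri : ∀ {a b c}, H a b → H b c → H c a → False := by
    intro a b c h1 h3 h4
    rcases h2 a h1.1 b h1.2.1 c h3.2.1 h1.2.2.1 h4.2.2.1.symm h3.2.2.1 with k | k | k
    · exact h1.2.2.2 k
    · exact h4.2.2.2 k.symm
    · exact h3.2.2.2 k
  have five1 : ∀ {a b c d e}, H a b → H b c → H c d → H d e → H e a → G.Adj a c := by
    intro a b c d e h1 h3 h4 h5 h6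
    by_contra k
    by_cases hac : a = c
    · subst hac
      exact tri h4 h5 h6
    · exact tri h1 h3 (Hs ⟨h1.1, h3.2.1, hac, k⟩)
  have five : ∀ {a b c d e}, H a b → H b c → H c d → H d e → H e a → False := by
    intro a b c d e h1 h3 h4 h5 h6
    refine hc5 a h1.1 c h4.1 e h6.1 b h3.1 d h5.1 ⟨⟨five1 h1 h3 h4 h5 h6, five1 h4 h5 h6 h1 h3,
      five1 h6 h1 h3 h4 h5, five1 h3 h4 h5 h6 h1, five1 h5 h6 h1 h3 h4⟩, ⟨(Hs h6).2.2.2, h1.2.2.2,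
      (Hs h3).2.2.2, h4.2.2.2, (Hs h5).2.2.2⟩, ⟨(Hs h6).2.2.1, h1.2.2.1,
      (Hs h3).2.2.1, h4.2.2.1, (Hs h5).2.2.1⟩⟩
  let N : V → Finset V := fun x => Y.filter (H x)
  have hD : ∀ {x y}, H x y → Y.card + 2 ≤ (N x).card + (N y).card + t := by
    intro x y h
    have h0 := hdeg x h.1 y h.2.1 h.2.2.1 h.2.2.2
    have : Y ⊆ N x ∪ N y ∪ ((Y \ {x, y}).filter fun w => G.Adj w x ∧ G.Adj w y) := by
      intro w hw
      simp only [N, Finset.mem_union, Finset.mem_filter, Finset.mem_sdiff, Finset.mem_insert,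
        Finset.mem_singleton]
      by_cases k1 : H x w
      · exact Or.inl (Or.inl ⟨hw, k1⟩)
      by_cases k2 : H y w
      · exact Or.inl (Or.inr ⟨hw, k2⟩)
      have e1 : w ≠ x := by rintro rfl; exact k2 (Hs h)
      have e2 : w ≠ y := by rintro rfl; exact k1 h
      refine Or.inr ⟨⟨hw, fun k => k.elim e1 e2⟩, ?_, ?_⟩
      · by_contra k
        exact k1 (Hs ⟨hw, h.1, e1, k⟩)
      · by_contra k
        exact k2 (Hs ⟨hw, h.2.1, e2, k⟩)
    have c1 := Finset.card_le_card this
    have c2 := Finset.card_union_le (N x ∪ N y) ((Y \ {x, y}).filter fun w => G.Adj w x ∧ G.Adj w y)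
    have c3 := Finset.card_union_le (N x) (N y)
    omega
  have seven : ∀ {w0 w1 w2 w3 w4 w5 w6}, H w0 w1 → H w1 w2 → H w2 w3 → H w3 w4 → H w4 w5 →
      H w5 w6 → H w6 w0 → False := by
    intro w0 w1 w2 w3 w4 w5 w6 h0 h1 h2' h3 h4 h5 h6
    have d0 := hD h0
    have d1 := hD h1
    have d2 := hD h2'
    have d3 := hD h3
    have d4 := hD h4
    have d5 := hD h5
    have d6 := hD h6
    have key : (N w0).card + (N w1).card + (N w2).card + (N w3).card + (N w4).card + (N w5).card
        + (N w6).card ≤ Y.card * 2 := by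
      simp only [N, Finset.card_filter, ← Finset.sum_add_distrib]
      refine (Finset.sum_le_card_nsmul _ _ 2 ?_)
      intro y hy
      have A : ∀ {a b}, H a b → (if H a y then 1 else 0) + (if H b y then 1 else 0) ≤ 1 := by
        intro a b hab
        by_cases k1 : H a y <;> by_cases k2 : H b y <;> simp [k1, k2]
        exact tri hab k2 (Hs k1)
      have B : ∀ {a b c d}, H a b → H b c → H c d →
          (if H a y then 1 else 0) + (if H d y then 1 else 0) ≤ 1 := by
        intro a b c d hab hbc hcd
        by_cases k1 : H a y <;> by_cases k2 : H d y <;> simp [k1, k2]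
        exact five hab hbc hcd k2 (Hs k1)
      exact seven_sum _ _ _ _ _ _ _ (A h0) (A h1) (A h2') (A h3) (A h4) (A h5) (A h6)
        (B h0 h1 h2') (B h1 h2' h3) (B h2' h3 h4) (B h3 h4 h5) (B h4 h5 h6) (B h5 h6 h0) (B h6 h0 h1)
    omega
  by_cases hH : ∃ x y, H x y
  swap
  · push Not at hH
    refine ⟨Y, subset_rfl, ?_, by omega⟩
    intro x hx y hy hxy
    by_contra k
    exact hH x y ⟨hx, hy, hxy, k⟩
  obtain ⟨x, y, hxy⟩ := hH
  let E : V → Prop := fun z => ∃ a b c, H z a ∧ H a b ∧ H b c ∧ H c x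
  let O : V → Prop := fun z => ∃ a b, H z a ∧ H a b ∧ H b x
  have hEO : ∀ z, E z → O z → False := by
    rintro z ⟨a, b, c, h1, h3, h4, h5⟩ ⟨a', b', k1, k2, k3⟩
    exact seven h1 h3 h4 h5 (Hs k3) (Hs k2) (Hs k1)
  have half : ∀ {z z' w}, H z z' → H z w → (H x w ∨ H y w) → (E z ∧ O z') ∨ (O z ∧ E z') := by
    intro z z' w h1 h3 h4
    rcases h4 with h4 | h4
    · exact Or.inl ⟨⟨w, x, y, h3, Hs h4, hxy, Hs hxy⟩, ⟨z, w, Hs h1, h3, Hs h4⟩⟩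
    · exact Or.inr ⟨⟨w, y, h3, Hs h4, Hs hxy⟩, ⟨z, w, y, Hs h1, h3, Hs h4, Hs hxy⟩⟩
  have cases : ∀ {z z'}, H z z' → (E z ∧ O z') ∨ (O z ∧ E z') := by
    intro z z' hz
    have dj : ∀ {a b}, H a b → (N a ∪ N b).card = (N a).card + (N b).card := by
      intro a b hab
      refine Finset.card_union_of_disjoint (Finset.disjoint_left.mpr ?_)
      intro w k1 k2
      exact tri hab (Finset.mem_filter.mp k2).2 (Hs (Finset.mem_filter.mp k1).2)
    have c1 := hD hz
    have c2 := hD hxy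
    rw [← dj hz] at c1
    rw [← dj hxy] at c2
    have sub : (N z ∪ N z') ∪ (N x ∪ N y) ⊆ Y :=
      Finset.union_subset (Finset.union_subset (Finset.filter_subset _ _) (Finset.filter_subset _ _))
        (Finset.union_subset (Finset.filter_subset _ _) (Finset.filter_subset _ _))
    have c3 := Finset.card_le_card sub
    have c4 : ¬ Disjoint (N z ∪ N z') (N x ∪ N y) := by
      intro hd
      rw [Finset.card_union_of_disjoint hd] at c3
      omega
    obtain ⟨w, hw1, hw2⟩ := Finset.not_disjoint_iff.mp c4
    simp only [N, Finset.mem_union, Finset.mem_filter] at hw1 hw2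
    have hw3 : H x w ∨ H y w := hw2.imp And.right And.right
    rcases hw1 with hw1 | hw1
    · exact half hz hw1.2 hw3
    · rcases half (Hs hz) hw1.2 hw3 with k | k
      · exact Or.inr ⟨k.2, k.1⟩
      · exact Or.inl ⟨k.2, k.1⟩
  have hsum := Finset.card_filter_add_card_filter_not (s := Y) E
  have cl1 : ∀ a ∈ Y.filter E, ∀ b ∈ Y.filter E, a ≠ b → G.Adj a b := by
    intro a ha b hb hab
    rw [Finset.mem_filter] at ha hb
    by_contra k
    rcases cases (z := a) (z' := b) ⟨ha.1, hb.1, hab, k⟩ with k | k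
    · exact hEO _ hb.2 k.2
    · exact hEO _ ha.2 k.1
  have cl2 : ∀ a ∈ Y.filter (fun z => ¬ E z), ∀ b ∈ Y.filter (fun z => ¬ E z), a ≠ b → G.Adj a b := by
    intro a ha b hb hab
    rw [Finset.mem_filter] at ha hb
    by_contra k
    rcases cases (z := a) (z' := b) ⟨ha.1, hb.1, hab, k⟩ with k | k
    · exact ha.2 k.1
    · exact hb.2 k.2
  by_cases hc : t ≤ (Y.filter E).card
  · exact ⟨_, Finset.filter_subset _ _, cl1, hc⟩
  · exact ⟨_, Finset.filter_subset _ _, cl2, by omega⟩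

lemma c5_pick {V : Type*} {G : SimpleGraph V} {Y : Finset V} {p v q r u : V}
    (hc : IsC5 G p v q r u) (hp : p ∈ Y) (hv : v ∈ Y) (hq : q ∈ Y) (hr : r ∈ Y) (hu : u ∈ Y)
    (h2 : A2 G Y) : ∃ p' ∈ Y, ∃ v' ∈ Y, ∃ q' ∈ Y, ∃ r' ∈ Y, ∃ u' ∈ Y, IsC5 G p' v' q' r' u' ∧
    5 * ((Y \ {p', v', q', r', u'}).filter fun y => ¬ G.Adj y q' ∧ ¬ G.Adj y r').card ≤
      (Y \ {p', v', q', r', u'}).card := by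
  have rotS : ∀ a b c d e : V, ({b, c, d, e, a} : Finset V) = {a, b, c, d, e} := by
    intro a b c d e
    ext x
    simp only [Finset.mem_insert, Finset.mem_singleton]
    tauto
  let F : V → V → ℕ := fun a b => ((Y \ {p, v, q, r, u}).filter fun y => ¬ G.Adj y a ∧ ¬ G.Adj y b).card
  have key : F p v + F v q + F q r + F r u + F u p ≤ (Y \ {p, v, q, r, u}).card * 1 := by
    simp only [F, Finset.card_filter, ← Finset.sum_add_distrib]
    refine (Finset.sum_le_card_nsmul _ _ 1 ?_)
    intro y hy
    simp only [Finset.mem_sdiff, Finset.mem_insert, Finset.mem_singleton, not_or] at hy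
    obtain ⟨hyY, y1, y2, y3, y4, y5⟩ := hy
    obtain ⟨-, ⟨n1, n2, n3, n4, n5⟩, ⟨e1, e2, e3, e4, e5⟩⟩ := hc
    have D : ∀ {a b}, a ∈ Y → b ∈ Y → y ≠ a → y ≠ b → a ≠ b → ¬ G.Adj a b → ¬ G.Adj y a → G.Adj y b := by
      intro a b ha hb k1 k2 k3 k4 k5
      rcases h2 y hyY a ha b hb k1 k2 k3 with k | k | k
      · exact absurd k k5
      · exact k
      · exact absurd k k4
    have m1 := D hp hq y1 y3 e1 n1
    have m2 := D hp hr y1 y4 e2 n2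
    have m3 := D hv hr y2 y4 e3 n3
    have m4 := D hv hu y2 y5 e4 n4
    have m5 := D hq hu y3 y5 e5 n5
    clear D h2 rotS
    by_cases a1 : G.Adj y p
    · by_cases a2 : G.Adj y v
      · by_cases a3 : G.Adj y q
        · by_cases a4 : G.Adj y r <;> by_cases a5 : G.Adj y u <;> simp [*]
        · have a5 := m5 a3
          by_cases a4 : G.Adj y r <;> simp [*]
      · have a4 := m3 a2
        have a5 := m4 a2
        by_cases a3 : G.Adj y q <;> simp [*]
    · have a3 := m1 a1
      have a4 := m2 a1
      by_cases a2 : G.Adj y v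
      · by_cases a5 : G.Adj y u <;> simp [*]
      · have a5 := m4 a2
        simp [*]
  have c1 := hc.rot
  have c2 := c1.rot
  have c3 := c2.rot
  have c4 := c3.rot
  have s1 := rotS p v q r u
  have s2 := (rotS v q r u p).trans s1
  have s3 := (rotS q r u p v).trans s2
  have s4 := (rotS r u p v q).trans s3
  by_cases k0 : 5 * F q r ≤ (Y \ {p, v, q, r, u}).card
  · exact ⟨p, hp, v, hv, q, hq, r, hr, u, hu, hc, k0⟩
  by_cases k1 : 5 * F r u ≤ (Y \ {p, v, q, r, u}).card
  · exact ⟨v, hv, q, hq, r, hr, u, hu, p, hp, c1, by rw [s1]; exact k1⟩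
  by_cases k2 : 5 * F u p ≤ (Y \ {p, v, q, r, u}).card
  · exact ⟨q, hq, r, hr, u, hu, p, hp, v, hv, c2, by rw [s2]; exact k2⟩
  by_cases k3 : 5 * F p v ≤ (Y \ {p, v, q, r, u}).card
  · exact ⟨r, hr, u, hu, p, hp, v, hv, q, hq, c3, by rw [s3]; exact k3⟩
  · exact ⟨u, hu, p, hp, v, hv, q, hq, r, hr, c4, by rw [s4]; change 5 * F v q ≤ _; omega⟩

lemma p2 {V : Type*} [Fintype V] {G : SimpleGraph V} : ∀ (t : ℕ) (Y : Finset V), A2 G Y →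
    5 * t ≤ 2 * Y.card → ImmX G Y t := by
  intro t
  induction t using Nat.strong_induction_on with
  | _ t ih =>
  intro Y h2 hn
  by_cases hcl : ∃ C ⊆ Y, (∀ x ∈ C, ∀ y ∈ C, x ≠ y → G.Adj x y) ∧ t ≤ C.card
  · obtain ⟨C, hCY, hC, hCt⟩ := hcl
    exact imm_mono (imm_clique hC hCt) hCY
  have A2mono : ∀ Z ⊆ Y, A2 G Z := fun Z hZ a ha b hb c hc => h2 a (hZ ha) b (hZ hb) c (hZ hc)
  have ht0 : 2 ≤ t := by
    by_contra h
    refine hcl ?_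
    rcases (by omega : t = 0 ∨ t = 1) with rfl | rfl
    · exact ⟨∅, by simp, by simp, by simp⟩
    · obtain ⟨y, hy⟩ : Y.Nonempty := Finset.card_pos.mp (by omega)
      exact ⟨{y}, by simpa using hy, by simp, by simp⟩
  by_cases hdeg : ∀ x ∈ Y, ∀ y ∈ Y, x ≠ y → ¬ G.Adj x y →
      ((Y \ {x, y}).filter fun w => G.Adj w x ∧ G.Adj w y).card + 2 ≤ t
  swap
  · push Not at hdeg
    obtain ⟨x, hx, y, hy, hxy, hnad, hlt⟩ := hdeg
    have hsub : ({x, y} : Finset V) ⊆ Y := by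
      intro w hw
      simp only [Finset.mem_insert, Finset.mem_singleton] at hw
      rcases hw with rfl | rfl <;> assumption
    have hcard := Finset.card_sdiff_of_subset hsub
    rw [Finset.card_pair hxy] at hcard
    have := ih (t - 1) (by omega) (Y \ {x, y}) (A2mono _ Finset.sdiff_subset) (by omega)
    have h3 := imm_add x (X := {x, y}) (by simp) hsub ?_ ?_ this
    · rwa [Nat.sub_add_cancel (by omega)] at h3
    · intro w hw
      simp only [Finset.mem_sdiff, Finset.mem_insert, Finset.mem_singleton, not_or] at hw
      rcases h2 w hw.1 x hx y hy hw.2.1 hw.2.2 hxy with k | k | k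
      · exact ⟨x, by simp, k⟩
      · exact ⟨y, by simp, k⟩
      · exact absurd k hnad
    · intro X' hX' hxX' hne
      have hy' : y ∉ X' := by
        intro h
        refine hne (Finset.Subset.antisymm hX' ?_)
        intro w hw
        simp only [Finset.mem_insert, Finset.mem_singleton] at hw
        rcases hw with rfl | rfl <;> assumption
      have hle : t - 1 ≤ ((Y \ {x, y}).filter fun w => G.Adj w x ∧ G.Adj w y).card := by omega
      refine hle.trans (Finset.card_le_card ?_)
      · intro w hw
        rw [Finset.mem_filter] at hw ⊢
        exact ⟨hw.1, ⟨x, hxX', hw.2.1⟩, ⟨y, by simp, hy', hw.2.2⟩⟩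
  by_cases hc5 : ∀ p ∈ Y, ∀ v ∈ Y, ∀ q ∈ Y, ∀ r ∈ Y, ∀ u ∈ Y, ¬ IsC5 G p v q r u
  · exact absurd (p2_struct h2 hn hdeg hc5) hcl
  push Not at hc5
  obtain ⟨p, hp, v, hv, q, hq, r, hr, u, hu, hc⟩ := hc5
  obtain ⟨p, hp, v, hv, q, hq, r, hr, u, hu, hc, hQR⟩ := c5_pick hc hp hv hq hr hu h2
  have hsub : ({p, v, q, r, u} : Finset V) ⊆ Y := by
    intro w hw
    simp only [Finset.mem_insert, Finset.mem_singleton] at hw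
    rcases hw with rfl | rfl | rfl | rfl | rfl <;> assumption
  have hcard := Finset.card_sdiff_of_subset hsub
  have h5 : ({p, v, q, r, u} : Finset V).card ≤ 5 := Finset.card_le_five
  have h6 := Finset.card_le_card hsub
  have h7 := ih (t - 2) (by omega) (Y \ {p, v, q, r, u}) (A2mono _ Finset.sdiff_subset) (by omega)
  have h8 := c5_step hc hp hv hq hr hu h2 ?_ (by omega) hQR h7
  · rwa [Nat.sub_add_cancel ht0] at h8
  · intro C hC hC2
    by_contra k
    exact hcl ⟨C, hC, hC2, by omega⟩

def IndLe {V : Type*} (G : SimpleGraph V) (Y : Finset V) (a : ℕ) : Prop :=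
  ∀ I ⊆ Y, (∀ x ∈ I, ∀ y ∈ I, ¬ G.Adj x y) → I.card ≤ a

def Cst (a : ℕ) : ℕ := if a ≤ 1 then 2 else 4 * a - 3

lemma general {V : Type*} [Fintype V] {G : SimpleGraph V} : ∀ (a : ℕ), 1 ≤ a →
    ∀ (t : ℕ) (Y : Finset V), IndLe G Y a → Cst a * t ≤ 2 * Y.card → ImmX G Y t := by
  intro a
  induction a using Nat.strong_induction_on with
  | _ a iha =>
  intro ha t
  induction t with
  | zero =>
    intro Y _ _
    exact imm_mono (imm_clique (Y := ∅) (by simp) (by simp)) (by simp)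
  | succ t iht =>
  intro Y hY hn
  rcases (by omega : a = 1 ∨ a = 2 ∨ 3 ≤ a) with rfl | rfl | ha3
  · refine imm_clique ?_ (by simp [Cst] at hn; omega)
    intro x hx y hy hxy
    by_contra k
    have := hY {x, y} (by
      intro w hw
      simp only [Finset.mem_insert, Finset.mem_singleton] at hw
      rcases hw with rfl | rfl <;> assumption) (by
      have k' : ¬ G.Adj y x := fun h => k h.symm
      simp [k, k'])
    rw [Finset.card_pair hxy] at this
    omega
  · refine p2 _ _ ?_ (by simp [Cst] at hn; omega)
    intro x hx y hy z hz hxy hxz hyz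
    by_contra k
    push Not at k
    obtain ⟨k1, k2, k3⟩ := k
    have := hY {x, y, z} (by
      intro w hw
      simp only [Finset.mem_insert, Finset.mem_singleton] at hw
      rcases hw with rfl | rfl | rfl <;> assumption) (by
      have k1' : ¬ G.Adj y x := fun h => k1 h.symm
      have k2' : ¬ G.Adj z x := fun h => k2 h.symm
      have k3' : ¬ G.Adj z y := fun h => k3 h.symm
      simp [k1, k2, k3, k1', k2', k3'])
    rw [Finset.card_eq_three.mpr ⟨x, y, z, hxy, hxz, hyz, rfl⟩] at this
    omega
  have hCa : Cst a = 4 * a - 3 := by simp [Cst]; omega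
  by_cases hS : IndLe G Y (a - 1)
  · refine iha (a - 1) (by omega) (by omega) (t + 1) Y hS (le_trans ?_ hn)
    refine Nat.mul_le_mul_right _ ?_
    rw [hCa]
    simp only [Cst]
    split_ifs <;> omega
  unfold IndLe at hS
  push Not at hS
  obtain ⟨S, hSY, hSI, hSc⟩ := hS
  have hSa : S.card = a := le_antisymm (hY S hSY hSI) (by omega)
  have hdom : ∀ y ∈ Y \ S, ∃ x ∈ S, G.Adj y x := by
    intro y hy
    rw [Finset.mem_sdiff] at hy
    by_contra k
    push Not at k
    have := hY (insert y S) (Finset.insert_subset hy.1 hSY) (by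
      intro x hx z hz
      rw [Finset.mem_insert] at hx hz
      rcases hx with rfl | hx <;> rcases hz with rfl | hz
      · exact G.loopless.irrefl _
      · exact k z hz
      · exact fun h => k x hx h.symm
      · exact hSI x hx z hz)
    rw [Finset.card_insert_of_notMem hy.2] at this
    omega
  have hYS := Finset.card_sdiff_of_subset hSY
  obtain ⟨u, hu⟩ : S.Nonempty := Finset.card_pos.mp (by omega)
  rw [hCa] at hn
  obtain ⟨c, rfl⟩ : ∃ c, a = c + 3 := ⟨a - 3, by omega⟩
  have hn' : (4 * c + 9) * t + (4 * c + 9) ≤ 2 * Y.card := by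
    have : 4 * (c + 3) - 3 = 4 * c + 9 := by omega
    rw [this] at hn
    linarith
  by_cases hmix : ∀ X' ⊆ S, u ∈ X' → X' ≠ S → t ≤ ((Y \ S).filter (fun y =>
      (∃ x ∈ X', G.Adj y x) ∧ ∃ x ∈ S, x ∉ X' ∧ G.Adj y x)).card
  · refine imm_add u hu hSY hdom hmix (iht (Y \ S) ?_ ?_)
    · exact fun I hI => hY I (hI.trans Finset.sdiff_subset)
    · rw [hCa]
      have : 4 * (c + 3) - 3 = 4 * c + 9 := by omega
      rw [this]
      omega
  push Not at hmix
  obtain ⟨S1, hS1, huS1, hne, hlt⟩ := hmix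
  set Mx := ((Y \ S).filter (fun y =>
      (∃ x ∈ S1, G.Adj y x) ∧ ∃ x ∈ S, x ∉ S1 ∧ G.Adj y x)) with hMx
  set S2 := S \ S1 with hS2
  have hS2S : S2 ⊆ S := Finset.sdiff_subset
  have hS2c := Finset.card_sdiff_of_subset hS1
  rw [← hS2] at hS2c
  have hS1c : 1 ≤ S1.card := Finset.card_pos.mpr ⟨u, huS1⟩
  have hS1lt : S1.card < S.card := Finset.card_lt_card (hS1.ssubset_of_ne hne)
  set Y1 := Y.filter (fun y => ∀ x ∈ S2, ¬ G.Adj y x ∧ y ≠ x) with hY1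
  set Y2 := Y.filter (fun y => ∀ x ∈ S1, ¬ G.Adj y x ∧ y ≠ x) with hY2
  have ind : ∀ T T' : Finset V, T ⊆ S → T' ⊆ S → T.card + T'.card = S.card →
      IndLe G (Y.filter (fun y => ∀ x ∈ T', ¬ G.Adj y x ∧ y ≠ x)) T.card := by
    intro T T' hT hT' hTT I hI hII
    have hm : ∀ y ∈ I, y ∈ Y ∧ ∀ x ∈ T', ¬ G.Adj y x ∧ y ≠ x := fun y hy =>
      Finset.mem_filter.mp (hI hy)
    have hd : Disjoint I T' := Finset.disjoint_left.mpr fun y hy hy' => ((hm y hy).2 y hy').2 rfl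
    have := hY (I ∪ T') (Finset.union_subset (fun y hy => (hm y hy).1) (hT'.trans hSY)) (by
      intro x hx z hz
      rw [Finset.mem_union] at hx hz
      rcases hx with hx | hx <;> rcases hz with hz | hz
      · exact hII x hx z hz
      · exact ((hm x hx).2 z hz).1
      · exact fun h => ((hm z hz).2 x hx).1 h.symm
      · exact hSI x (hT' hx) z (hT' hz))
    rw [Finset.card_union_of_disjoint hd] at this
    omega
  have i1 := ind S1 S2 hS1 hS2S (by omega)
  have i2 := ind S2 S1 hS2S hS1 (by omega)
  have cover : Y ⊆ Y1 ∪ Y2 ∪ Mx := by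
    intro y hy
    simp only [Finset.mem_union]
    by_cases hyS : y ∈ S
    · by_cases hy1 : y ∈ S1
      · refine Or.inl (Or.inl (Finset.mem_filter.mpr ⟨hy, fun x hx => ⟨hSI y hyS x (hS2S hx), ?_⟩⟩))
        rintro rfl
        exact (Finset.mem_sdiff.mp hx).2 hy1
      · refine Or.inl (Or.inr (Finset.mem_filter.mpr ⟨hy, fun x hx => ⟨hSI y hyS x (hS1 hx), ?_⟩⟩))
        rintro rfl
        exact hy1 hx
    · by_cases k1 : ∃ x ∈ S1, G.Adj y x
      · by_cases k2 : ∃ x ∈ S, x ∉ S1 ∧ G.Adj y x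
        · exact Or.inr (Finset.mem_filter.mpr ⟨Finset.mem_sdiff.mpr ⟨hy, hyS⟩, k1, k2⟩)
        · refine Or.inl (Or.inl (Finset.mem_filter.mpr ⟨hy, fun x hx => ⟨fun h => k2 ?_, ?_⟩⟩))
          · exact ⟨x, hS2S hx, (Finset.mem_sdiff.mp hx).2, h⟩
          · rintro rfl; exact hyS (hS2S hx)
      · refine Or.inl (Or.inr (Finset.mem_filter.mpr ⟨hy, fun x hx => ⟨fun h => k1 ⟨x, hx, h⟩, ?_⟩⟩))
        rintro rfl; exact hyS (hS1 hx)
  have c1 := Finset.card_le_card cover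
  have c2 := Finset.card_union_le (Y1 ∪ Y2) Mx
  have c3 := Finset.card_union_le Y1 Y2
  by_cases p1 : Cst S1.card * (t + 1) ≤ 2 * Y1.card
  · exact imm_mono (iha S1.card (by omega) hS1c (t + 1) Y1 i1 p1) (Finset.filter_subset _ _)
  by_cases p2 : Cst S2.card * (t + 1) ≤ 2 * Y2.card
  · exact imm_mono (iha S2.card (by omega) (by omega) (t + 1) Y2 i2 p2) (Finset.filter_subset _ _)
  exfalso
  have hC : Cst S1.card + Cst S2.card + 2 ≤ 4 * c + 9 := by
    simp only [Cst]
    split_ifs <;> omega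
  have hC2 := Nat.mul_le_mul_right (t + 1) hC
  rw [add_mul, add_mul] at hC2
  have e : (4 * c + 9) * (t + 1) = (4 * c + 9) * t + (4 * c + 9) := by ring
  omega

lemma imm_conv {V : Type*} {G : SimpleGraph V} {Y : Finset V} {t : ℕ} (h : ImmX G Y t) :
    CliqueImmersion G t := by
  obtain ⟨M, F, hMY, hMt, hF1, hF2⟩ := h
  subst hMt
  let φ : Fin M.card → V := fun i => (M.equivFin.symm i).1
  have hφ : Function.Injective φ := fun i j hij => M.equivFin.symm.injective (Subtype.ext hij)
  have hm : ∀ i, φ i ∈ M := fun i => (M.equivFin.symm i).2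
  have ex : ∀ i j, ∃ P : G.Walk (φ i) (φ j), P.IsPath ∧
      (i ≠ j → ∀ x y, s(x, y) ∈ P.edges → (F s(φ i, φ j)).Adj x y) := by
    intro i j
    by_cases hij : i = j
    · subst hij
      exact ⟨SimpleGraph.Walk.nil, SimpleGraph.Walk.IsPath.nil, fun h => absurd rfl h⟩
    · have hne : φ i ≠ φ j := fun h => hij (hφ h)
      obtain ⟨k1, k2⟩ := hF1 (φ i) (hm i) (φ j) (hm j) hne
      obtain ⟨P, hP⟩ := k2.exists_isPath
      have hle : F s(φ i, φ j) ≤ G := fun x y hxy => (k1 x y hxy).1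
      refine ⟨P.mapLe hle, (SimpleGraph.Walk.mapLe_isPath hle).mpr hP, fun _ x y hxy => ?_⟩
      rw [SimpleGraph.Walk.edges_mapLe_eq_edges] at hxy
      exact P.adj_of_mem_edges hxy
  choose P hP1 hP2 using ex
  refine ⟨φ, P, hφ, fun i j _ => hP1 i j, ?_⟩
  intro i j i' j' hij hij' hne e he he'
  induction e using Sym2.ind with
  | _ x y =>
  refine hF2 (φ i) (hm i) (φ j) (hm j) (φ i') (hm i') (φ j') (hm j') (fun h => hij.ne (hφ h))
    (fun h => hij'.ne (hφ h)) ?_ x y (hP2 i j hij.ne x y he) (hP2 i' j' hij'.ne x y he')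
  intro h
  rw [Sym2.eq_iff] at h
  rcases h with ⟨h1, h2⟩ | ⟨h1, h2⟩
  · exact hne (by rw [hφ h1, hφ h2])
  · have a1 := hφ h1
    have a2 := hφ h2
    subst a1 a2
    exact absurd hij (not_lt.mpr hij'.le)

lemma fMain_le (a : ℕ) (ha : 3 ≤ a) : 2 * (a : ℚ) - 3 / 2 ≤ 9 / 4 * (a : ℚ) - fMain a := by
  rcases (by omega : a = 3 ∨ a = 4 ∨ 5 ≤ a) with rfl | rfl | h
  · norm_num [fMain]
  · norm_num [fMain]
  · have key : ∀ b : ℕ, ∑ i ∈ Finset.Icc 6 (b + 6), 1 / (2 * (i : ℚ)) ≤ (1 / 4 : ℚ) * (b + 1) := by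
      intro b
      induction b with
      | zero => norm_num
      | succ b ih =>
        rw [show b + 1 + 6 = (b + 6) + 1 by ring, Finset.sum_Icc_succ_top (by omega)]
        have : 1 / (2 * ((b + 6 + 1 : ℕ) : ℚ)) ≤ 1 / 4 := by
          rw [div_le_div_iff₀ (by positivity) (by norm_num)]
          push_cast
          have : (0 : ℚ) ≤ b := by positivity
          linarith
        push_cast at this ⊢
        push_cast at ih
        linarith
    obtain ⟨b, rfl⟩ : ∃ b, a = b + 5 := ⟨a - 5, by omega⟩
    have := key b
    have hf : fMain (b + 5) = 9 / 4 + ∑ i ∈ Finset.Icc 6 (b + 6), 1 / (2 * (i : ℚ)) := by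
      unfold fMain
      rw [if_neg (by omega)]
    rw [hf]
    push_cast
    linarith

end Helpers

/-- Every `n`-vertex graph with independence number `α ≥ 3` contains an immersion of a
clique on at least `⌊n / (2.25 α - f α)⌋ - 1` vertices. -/
theorem clique_immersion_of_indepNum {V : Type*} [Fintype V] (G : SimpleGraph V)
    (n α : ℕ) (hn : Fintype.card V = n) (hα : 3 ≤ α) (hind : IndepNumEq G α) :
    ∃ k : ℕ, ⌊(n : ℚ) / ((9 / 4 : ℚ) * (α : ℚ) - fMain α)⌋ - 1 ≤ (k : ℤ) ∧
      CliqueImmersion G k := by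
  have hd := fMain_le α hα
  set d : ℚ := (9 / 4 : ℚ) * (α : ℚ) - fMain α with hdd
  have hα' : (3 : ℚ) ≤ α := by exact_mod_cast hα
  have hdpos : 0 < d := by linarith
  refine ⟨(⌊(n : ℚ) / d⌋ - 1).toNat, Int.self_le_toNat _, ?_⟩
  set t := (⌊(n : ℚ) / d⌋ - 1).toNat with ht
  refine imm_conv (Y := Finset.univ) (general α (by omega) t Finset.univ ?_ ?_)
  · intro I _ hI
    exact hind.2 I fun x hx y hy _ => hI x hx y hy
  · rw [Finset.card_univ, hn]
    have hC : Cst α = 4 * α - 3 := by unfold Cst; rw [if_neg (by omega)]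
    rcases Nat.eq_zero_or_pos t with h0 | h0
    · rw [h0]; simp
    · have h1 : ((t : ℤ) + 1) = ⌊(n : ℚ) / d⌋ := by omega
      have h3 := Int.floor_le ((n : ℚ) / d)
      rw [← h1, le_div_iff₀ hdpos] at h3
      push_cast at h3
      have h4 : (4 * (α : ℚ) - 3) * t ≤ 2 * n := by
        have : (0 : ℚ) ≤ t := by positivity
        nlinarith
      have h5 : ((4 * α - 3 : ℕ) : ℚ) = 4 * (α : ℚ) - 3 := by
        rw [Nat.cast_sub (by omega)]; push_cast; ring
      rw [hC]
      rw [← h5] at h4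
      exact_mod_cast h4
end

section
/- Let α be an integer with 1 ≤ α ≤ 10 and let G be a graph on n vertices whose independence number equals α. Then G contains an immersion of a complete graph on at least ⌊n/(2α)⌋ − 1 vertices. -/
open Classical in
theorem im_pathflow {V : Type*} [Fintype V] (B : SimpleGraph V) (R : V → V → Prop) {x y : V}
    (p : B.Walk x y) (hp : p.IsPath) (hR : ∀ d ∈ p.darts, R d.fst d.snd) :
    ∃ g : V → V → ℤ, (∀ a b, g a b = - g b a) ∧
      (∀ v, ∑ b, g v b = (if v = x then 1 else 0) - (if v = y then 1 else 0)) ∧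
      (∀ a b, g a b ≤ 1) ∧ (∀ a b, 0 < g a b → R a b ∧ B.Adj a b) ∧
      (∀ a b, g a b ≠ 0 → a ∈ p.support) ∧ (∀ d ∈ p.darts, g d.fst d.snd = 1) := by
  induction p with
  | nil =>
    refine ⟨fun _ _ => 0, ?_, ?_, ?_, ?_, ?_, ?_⟩ <;> simp
  | @cons x z y h q ih =>
    rw [SimpleGraph.Walk.cons_isPath_iff] at hp
    obtain ⟨g, h1, h2, h3, h4, h5, h6⟩ := ih hp.1 (fun d hd => hR d (by simp [hd]))
    have hx : ∀ b, g x b = 0 := fun b => by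
      by_contra hne
      exact hp.2 (h5 x b hne)
    have hx' : ∀ b, g b x = 0 := fun b => by rw [h1, hx]; simp
    have hRxz : R x z := hR ⟨(x, z), h⟩ (by simp)
    have hne : x ≠ z := h.ne
    refine ⟨fun a b => g a b + ((if a = x ∧ b = z then 1 else 0)
      - (if a = z ∧ b = x then 1 else 0)), ?_, ?_, ?_, ?_, ?_, ?_⟩
    · intro a b
      have := h1 a b
      simp only [and_comm (a := b = _)]
      linarith
    · intro v
      rw [Finset.sum_add_distrib, h2, Finset.sum_sub_distrib]
      have e1 : ∀ u w : V, ∑ b, (if v = u ∧ b = w then (1:ℤ) else 0) = if v = u then 1 else 0 := by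
        intro u w
        by_cases hv : v = u <;> simp [hv]
      rw [e1, e1]
      ring
    · intro a b
      by_cases ha : a = x
      · subst ha; simp only [hx]; split_ifs <;> simp
      · have := h3 a b
        simp only [ha, false_and, if_false]
        split_ifs <;> linarith
    · intro a b hab
      by_cases hh : a = x ∧ b = z
      · rw [hh.1, hh.2]; exact ⟨hRxz, h⟩
      · apply h4
        simp only [hh, if_false] at hab
        split_ifs at hab <;> linarith
    · intro a b hab
      simp only [SimpleGraph.Walk.support_cons, List.mem_cons]
      by_cases hh : a = x
      · exact Or.inl hh
      · right
        by_cases hz : a = z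
        · rw [hz]; exact q.start_mem_support
        · apply h5 a b
          simpa [hh, hz] using hab
    · intro d hd
      simp only [SimpleGraph.Walk.darts_cons, List.mem_cons] at hd
      rcases hd with rfl | hd
      · simp [hx, hne]
      · have hg := h6 d hd
        have n1 : d.fst ≠ x := fun e => by rw [e, hx] at hg; simp at hg
        have n2 : d.snd ≠ x := fun e => by rw [e, hx'] at hg; simp at hg
        simp [n1, n2, hg]

open Classical in
theorem im_reach {V : Type*} [Fintype V] (B : SimpleGraph V) (R : V → V → Prop) (x t : V) :
    (∃ p : B.Walk x t, p.IsPath ∧ ∀ d ∈ p.darts, R d.fst d.snd) ∨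
    (∃ X : Finset V, x ∈ X ∧ t ∉ X ∧ ∀ a ∈ X, ∀ b, b ∉ X → B.Adj a b → ¬ R a b) := by
  by_cases h : ∃ p : B.Walk x t, ∀ d ∈ p.darts, R d.fst d.snd
  · obtain ⟨p, hp⟩ := h
    exact Or.inl ⟨p.bypass, p.bypass_isPath, fun d hd => hp d (p.darts_bypass_subset_darts hd)⟩
  · right
    refine ⟨Finset.univ.filter (fun v => ∃ p : B.Walk x v, ∀ d ∈ p.darts, R d.fst d.snd),
      ?_, ?_, ?_⟩
    · simp only [Finset.mem_filter, Finset.mem_univ, true_and]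
      exact ⟨SimpleGraph.Walk.nil, by simp⟩
    · simpa using h
    · intro a ha b hb hab hR
      simp only [Finset.mem_filter, Finset.mem_univ, true_and] at ha hb
      obtain ⟨p, hp⟩ := ha
      apply hb
      refine ⟨p.concat hab, ?_⟩
      intro d hd
      rw [SimpleGraph.Walk.darts_concat, List.concat_eq_append, List.mem_append] at hd
      rcases hd with hd | hd
      · exact hp d hd
      · simp only [List.mem_singleton] at hd
        subst hd; exact hR

open Classical in
theorem im_sumcut {V : Type*} [Fintype V] (f : V → V → ℤ) (h1 : ∀ a b, f a b = - f b a)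
    (X : Finset V) : ∑ v ∈ X, ∑ b, f v b = ∑ v ∈ X, ∑ b ∈ Xᶜ, f v b := by
  have h0 : ∑ v ∈ X, ∑ b ∈ X, f v b = 0 := by
    have : ∑ v ∈ X, ∑ b ∈ X, f v b = - ∑ v ∈ X, ∑ b ∈ X, f v b := by
      conv_lhs => rw [Finset.sum_comm]
      rw [← Finset.sum_neg_distrib]
      refine Finset.sum_congr rfl fun a _ => ?_
      rw [← Finset.sum_neg_distrib]
      exact Finset.sum_congr rfl fun b _ => h1 b a
    linarith
  have : ∀ v ∈ X, ∑ b, f v b = ∑ b ∈ X, f v b + ∑ b ∈ Xᶜ, f v b := fun v _ =>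
    (Finset.sum_add_sum_compl X _).symm
  rw [Finset.sum_congr rfl this, Finset.sum_add_distrib, h0, zero_add]

/-- unit flow sending one unit from every vertex of `M` to `t`. -/
def ImFlow {V : Type*} [Fintype V] (B : SimpleGraph V) (t : V) (M : Finset V)
    (f : V → V → ℤ) : Prop :=
  (∀ a b, f a b = - f b a) ∧ (∀ a b, f a b ≤ 1) ∧ (∀ a b, f a b ≠ 0 → B.Adj a b) ∧
  (∀ v, v ≠ t → v ∈ M → ∑ b, f v b = 1) ∧ (∀ v, v ≠ t → v ∉ M → ∑ b, f v b = 0)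

open Classical in
theorem ImFlow.sum_eq {V : Type*} [Fintype V] {B : SimpleGraph V} {t : V} {M : Finset V}
    {f : V → V → ℤ} (h : ImFlow B t M f) (X : Finset V) (hX : t ∉ X) :
    ∑ v ∈ X, ∑ b ∈ Xᶜ, f v b = (M ∩ X).card := by
  rw [← im_sumcut f h.1, Finset.inter_comm, ← Finset.filter_mem_eq_inter, Finset.card_filter]
  push_cast
  refine Finset.sum_congr rfl fun v hv => ?_
  have hvt : v ≠ t := fun e => hX (e ▸ hv)
  by_cases hm : v ∈ M
  · rw [h.2.2.2.1 v hvt hm, if_pos hm]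
  · rw [h.2.2.2.2 v hvt hm, if_neg hm]

open Classical in
theorem im_flow_exists {V : Type*} [Fintype V] (B : SimpleGraph V) (t : V) (M : Finset V)
    (hcut : ∀ X : Finset V, t ∉ X →
      (M ∩ X).card ≤ ((X ×ˢ Xᶜ).filter (fun q => B.Adj q.1 q.2)).card) :
    ∀ M' : Finset V, M' ⊆ M → ∃ f, ImFlow B t M' f := by
  intro M'
  induction M' using Finset.induction_on with
  | empty =>
    intro _
    exact ⟨fun _ _ => 0, by simp, by simp, by simp, by simp, by simp⟩
  | @insert m M' hm ih =>
    intro hsub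
    obtain ⟨f, hf⟩ := ih (fun x hx => hsub (Finset.mem_insert_of_mem hx))
    have hmM : m ∈ M := hsub (Finset.mem_insert_self _ _)
    rcases im_reach B (fun a b => f a b ≤ 0) m t with ⟨p, hp, hd⟩ | ⟨X, hmX, htX, hX⟩
    · obtain ⟨g, g1, g2, g3, g4, g5, g6⟩ := im_pathflow B (fun a b => f a b ≤ 0) p hp hd
      obtain ⟨f1, f2, f3, f4, f5⟩ := hf
      refine ⟨fun a b => f a b + g a b, ?_, ?_, ?_, ?_, ?_⟩
      · intro a b
        have := f1 a b
        have := g1 a b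
        linarith
      · intro a b
        by_cases h : 0 < g a b
        · have := (g4 a b h).1
          have := g3 a b
          linarith
        · have := f2 a b
          linarith
      · intro a b hab
        by_cases h : f a b = 0
        · have hg : g a b ≠ 0 := by simpa [h] using hab
          rcases lt_or_gt_of_ne hg with h' | h'
          · have := g1 a b
            exact (g4 b a (by linarith)).2.symm
          · exact (g4 a b h').2
        · exact f3 a b h
      · intro v hv hvM
        rw [Finset.sum_add_distrib, g2, if_neg hv]
        by_cases hvm : v = m
        · rw [f5 v hv (hvm ▸ hm)]; simp [hvm]
        · rw [f4 v hv (Finset.mem_of_mem_insert_of_ne hvM hvm)]; simp [hvm]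
      · intro v hv hvM
        rw [Finset.mem_insert, not_or] at hvM
        rw [Finset.sum_add_distrib, g2, if_neg hv, f5 v hv hvM.2, if_neg hvM.1]; simp
    · exfalso
      have hs := hf.sum_eq X htX
      obtain ⟨f1, f2, f3, f4, f5⟩ := hf
      have : ∑ v ∈ X, ∑ b ∈ Xᶜ, f v b
          = ((X ×ˢ Xᶜ).filter (fun q => B.Adj q.1 q.2)).card := by
        rw [Finset.card_filter, Finset.sum_product]
        push_cast
        refine Finset.sum_congr rfl fun a ha => Finset.sum_congr rfl fun b hb => ?_
        by_cases hab : B.Adj a b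
        · have := hX a ha b (Finset.mem_compl.1 hb) hab
          have := f2 a b
          rw [if_pos hab]; omega
        · rw [if_neg hab]
          by_contra hne
          exact hab (f3 a b hne)
      have h2 := hcut X htX
      have h3 : (M' ∩ X).card < (M ∩ X).card := by
        apply Finset.card_lt_card
        rw [Finset.ssubset_iff_of_subset
          (Finset.inter_subset_inter_right (fun x hx => hsub (Finset.mem_insert_of_mem hx)))]
        exact ⟨m, Finset.mem_inter.2 ⟨hmM, hmX⟩, fun h => hm (Finset.mem_inter.1 h).1⟩
      omega

open Classical in
theorem im_decomp {V : Type*} [Fintype V] (B : SimpleGraph V) (t : V) :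
    ∀ (M : Finset V), t ∉ M → ∀ f, ImFlow B t M f →
    ∃ c : Sym2 V → V, ∀ m ∈ M, ∃ p : B.Walk m t,
      (∀ a b, s(a, b) ∈ p.edges → f a b ≠ 0) ∧ ∀ e ∈ p.edges, c e = m := by
  intro M
  induction M using Finset.induction_on with
  | empty => intro _ f _; exact ⟨fun _ => t, by simp⟩
  | @insert m M hm ih =>
    intro ht f hf
    rcases im_reach B (fun a b => 0 < f a b) m t with ⟨p, hp, hd⟩ | ⟨X, hmX, htX, hX⟩
    · obtain ⟨g, g1, g2, g3, g4, g5, g6⟩ := im_pathflow B (fun a b => 0 < f a b) p hp hd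
      obtain ⟨f1, f2, f3, f4, f5⟩ := hf
      have hmt : m ≠ t := fun e => ht (by simp [e])
      have hfg : ∀ a b, f a b = 0 → g a b = 0 := by
        intro a b h
        by_contra hg
        rcases lt_or_gt_of_ne hg with h' | h'
        · have := g1 a b
          have h4 := (g4 b a (by linarith)).1
          have := f1 a b
          linarith
        · have h4 := (g4 a b h').1
          linarith
      have hpe : ∀ a b, s(a, b) ∈ p.edges → f a b - g a b = 0 ∧ f a b ≠ 0 := by
        intro a b hab
        rw [SimpleGraph.Walk.edges, List.mem_map] at hab
        obtain ⟨d, hdp, hde⟩ := hab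
        have h6 := g6 d hdp
        have h7 := hd d hdp
        have h8 := f2 d.fst d.snd
        have e1 := f1 d.fst d.snd
        have e2 := g1 d.fst d.snd
        have : s(d.fst, d.snd) = s(a, b) := hde
        rw [Sym2.eq_iff] at this
        rcases this with ⟨rfl, rfl⟩ | ⟨rfl, rfl⟩ <;> constructor <;> omega
      have hflow : ImFlow B t M (fun a b => f a b - g a b) := by
        refine ⟨?_, ?_, ?_, ?_, ?_⟩
        · intro a b
          have := f1 a b
          have := g1 a b
          linarith
        · intro a b
          by_cases h : g a b < 0
          · have e := g1 a b
            have h4 := (g4 b a (by linarith)).1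
            have := g3 b a
            have := f1 a b
            show f a b - g a b ≤ 1
            omega
          · have := f2 a b
            show f a b - g a b ≤ 1
            omega
        · intro a b hab
          apply f3
          intro h
          apply hab
          simp [h, hfg a b h]
        · intro v hv hvM
          have hvm : v ≠ m := fun e => hm (e ▸ hvM)
          rw [Finset.sum_sub_distrib, g2, if_neg hv, if_neg hvm,
            f4 v hv (Finset.mem_insert_of_mem hvM)]; simp
        · intro v hv hvM
          rw [Finset.sum_sub_distrib, g2, if_neg hv]
          by_cases hvm : v = m
          · rw [f4 v hv (by simp [hvm])]; simp [hvm]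
          · rw [f5 v hv (by simp [hvm, hvM])]; simp [hvm]
      obtain ⟨c, hc⟩ := ih (fun h => ht (Finset.mem_insert_of_mem h)) _ hflow
      refine ⟨fun e => if e ∈ p.edges then m else c e, ?_⟩
      intro m' hm'
      rw [Finset.mem_insert] at hm'
      rcases hm' with rfl | hm'
      · exact ⟨p, fun a b h => (hpe a b h).2, fun e he => by simp [he]⟩
      · obtain ⟨q, hq1, hq2⟩ := hc m' hm'
        refine ⟨q, ?_, ?_⟩
        · intro a b hab h
          apply hq1 a b hab
          simp [h, hfg a b h]
        · intro e he
          have : e ∉ p.edges := by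
            induction e using Sym2.ind with
            | _ a b =>
              intro h
              exact hq1 a b he (hpe a b h).1
          simp [this, hq2 e he]
    · exfalso
      have hs := hf.sum_eq X htX
      have h1 : ∑ v ∈ X, ∑ b ∈ Xᶜ, f v b ≤ 0 := by
        refine Finset.sum_nonpos fun a ha => Finset.sum_nonpos fun b hb => ?_
        by_contra hpos
        have hpos : 0 < f a b := not_le.1 hpos
        exact hX a ha b (Finset.mem_compl.1 hb) (hf.2.2.1 a b hpos.ne') hpos
      have h2 : 0 < (insert m M ∩ X).card :=
        Finset.card_pos.2 ⟨m, Finset.mem_inter.2 ⟨Finset.mem_insert_self _ _, hmX⟩⟩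
      omega

open Classical in
theorem im_fan {V : Type*} [Fintype V] (B : SimpleGraph V) (t : V) (M : Finset V) (ht : t ∉ M)
    (hcut : ∀ X : Finset V, t ∉ X →
      (M ∩ X).card ≤ ((X ×ˢ Xᶜ).filter (fun q => B.Adj q.1 q.2)).card) :
    ∃ c : Sym2 V → V, ∀ m ∈ M, ∃ p : B.Walk m t, ∀ e ∈ p.edges, c e = m := by
  obtain ⟨f, hf⟩ := im_flow_exists B t M hcut M (Finset.Subset.refl _)
  obtain ⟨c, hc⟩ := im_decomp B t M ht f hf
  exact ⟨c, fun m hm => (hc m hm).imp fun p hp => hp.2⟩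

/-- clique immersion inside a vertex set, as an edge colouring -/
def ImIn {V : Type*} (G : SimpleGraph V) (A : Finset V) (k : ℕ) : Prop :=
  ∃ M : Finset V, M ⊆ A ∧ M.card = k ∧ ∃ c : Sym2 V → Sym2 V,
    ∀ u ∈ M, ∀ v ∈ M, u ≠ v → ∃ p : G.Walk u v,
      (∀ x ∈ p.support, x ∈ A) ∧ ∀ e ∈ p.edges, c e = s(u, v)

def ImIndep {V : Type*} (G : SimpleGraph V) (I : Finset V) : Prop :=
  (I : Set V).Pairwise (fun x y => ¬ G.Adj x y)

theorem ImIn.mono {V : Type*} {G : SimpleGraph V} {A A' : Finset V} {k : ℕ} (h : ImIn G A k)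
    (hA : A ⊆ A') : ImIn G A' k := by
  obtain ⟨M, h1, h2, c, hc⟩ := h
  refine ⟨M, h1.trans hA, h2, c, fun u hu v hv huv => ?_⟩
  obtain ⟨p, hp, hq⟩ := hc u hu v hv huv
  exact ⟨p, fun x hx => hA (hp x hx), hq⟩

theorem ImIn.cliqueImmersion {V : Type*} {G : SimpleGraph V} {A : Finset V} {k : ℕ}
    (h : ImIn G A k) : CliqueImmersion G k := by
  classical
  obtain ⟨M, h1, h2, c, hc⟩ := h
  let e := (M.equivFinOfCardEq h2).symm
  have key : ∀ u v : Fin k, ∃ p : G.Walk (e u : V) (e v), u < v → p.IsPath ∧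
      ∀ x ∈ p.edges, c x = s((e u : V), (e v : V)) := by
    intro u v
    by_cases huv : u = v
    · subst huv
      exact ⟨SimpleGraph.Walk.nil, fun h => absurd h (lt_irrefl _)⟩
    · obtain ⟨p, _, hp⟩ := hc (e u) (e u).2 (e v) (e v).2
        (fun h => huv (e.injective (Subtype.ext h)))
      exact ⟨p.bypass, fun _ => ⟨p.bypass_isPath, fun x hx => hp x (p.edges_bypass_subset_edges hx)⟩⟩
  choose P hP using key
  refine ⟨fun u => e u, P, ?_, fun u v h => (hP u v h).1, ?_⟩
  · intro u v h
    exact e.injective (Subtype.ext h)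
  · intro u v u' v' h h' hne x hx hx'
    have e1 := (hP u v h).2 x hx
    have e2 := (hP u' v' h').2 x hx'
    rw [e1, Sym2.eq_iff] at e2
    have inj : ∀ a b : Fin k, (e a : V) = e b → a = b := fun a b h =>
      e.injective (Subtype.ext h)
    rcases e2 with ⟨a, b⟩ | ⟨a, b⟩
    · exact hne (by rw [inj _ _ a, inj _ _ b])
    · have := inj _ _ a
      have := inj _ _ b
      subst_vars
      exact lt_asymm h h'

theorem im_main {V : Type*} [Fintype V] (G : SimpleGraph V) :
    ∀ (N : ℕ) (A : Finset V) (α k : ℕ), A.card = N → 1 ≤ α →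
      (∀ I ⊆ A, ImIndep G I → I.card ≤ α) → (2 * α - 1) * k ≤ A.card → ImIn G A k := by
  classical
  intro N
  induction N using Nat.strong_induction_on with
  | _ N ih =>
  intro A α k hN hα hind hk
  rcases k with _ | k
  · exact ⟨∅, by simp, rfl, id, by simp⟩
  -- maximum independent set
  obtain ⟨I, hI, hImax⟩ := Finset.exists_max_image (A.powerset.filter (fun I => ImIndep G I))
    Finset.card ⟨∅, Finset.mem_filter.2 ⟨by simp, by simp [ImIndep]⟩⟩
  simp only [Finset.mem_filter, Finset.mem_powerset] at hI hImax
  obtain ⟨hIA, hII⟩ := hI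
  have hmax : ∀ S ⊆ A, ImIndep G S → S.card ≤ I.card := fun S h1 h2 => hImax S ⟨h1, h2⟩
  have hApos : 0 < A.card := by
    have : 0 < (2 * α - 1) * (k + 1) := Nat.mul_pos (by omega) (by omega)
    omega
  have hIpos : 1 ≤ I.card := by
    obtain ⟨a, ha⟩ := Finset.card_pos.1 hApos
    have := hmax {a} (by simpa using ha) (by simp [ImIndep])
    simpa using this
  have hIα := hind I hIA hII
  have hk' : (2 * I.card - 1) * (k + 1) ≤ A.card :=
    le_trans (Nat.mul_le_mul_right _ (by omega)) hk
  obtain ⟨t, htI⟩ := Finset.card_pos.1 hIpos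
  -- sets of vertices seeing only J
  let AJ : Finset V → Finset V := fun J => A.filter (fun x => ∀ i ∈ I \ J, x ≠ i ∧ ¬ G.Adj x i)
  have hAJind : ∀ J ⊆ I, ∀ S ⊆ AJ J, ImIndep G S → S.card ≤ J.card := by
    intro J hJ S hS hSi
    have hS' : ∀ x ∈ S, x ∈ A ∧ ∀ i ∈ I \ J, x ≠ i ∧ ¬ G.Adj x i := fun x hx =>
      Finset.mem_filter.1 (hS hx)
    have hdisj : Disjoint S (I \ J) := Finset.disjoint_left.2 fun x hx hx' =>
      ((hS' x hx).2 x hx').1 rfl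
    have hc := hmax (S ∪ (I \ J)) (Finset.union_subset (fun x hx => (hS' x hx).1)
      (Finset.sdiff_subset.trans hIA)) (by
        intro x hx y hy hxy
        simp only [Finset.coe_union, Set.mem_union, Finset.mem_coe] at hx hy
        rcases hx with hx | hx <;> rcases hy with hy | hy
        · exact hSi hx hy hxy
        · exact ((hS' x hx).2 y hy).2
        · exact fun h => ((hS' y hy).2 x hx).2 h.symm
        · exact hII (Finset.sdiff_subset hx) (Finset.sdiff_subset hy) hxy)
    rw [Finset.card_union_of_disjoint hdisj, Finset.card_sdiff_of_subset hJ] at hc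
    have := Finset.card_le_card hJ
    omega
  have hAJA : ∀ J, AJ J ⊆ A := fun J => Finset.filter_subset _ _
  by_cases hbig : ∃ J ⊆ I, J.Nonempty ∧ J ≠ I ∧ (2 * J.card - 1) * (k + 1) ≤ (AJ J).card
  · obtain ⟨J, hJI, hJne, hJI', hJ⟩ := hbig
    refine ImIn.mono (ih (AJ J).card ?_ (AJ J) J.card (k + 1) rfl (Finset.card_pos.2 hJne)
      (hAJind J hJI) hJ) (hAJA J)
    rw [← hN]
    apply Finset.card_lt_card
    rw [Finset.ssubset_iff_of_subset (hAJA J)]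
    obtain ⟨i, hi, hi'⟩ := Finset.exists_of_ssubset (Finset.ssubset_iff_subset_ne.2 ⟨hJI, hJI'⟩)
    refine ⟨i, hIA hi, fun h => ?_⟩
    exact ((Finset.mem_filter.1 h).2 i (Finset.mem_sdiff.2 ⟨hi, hi'⟩)).1 rfl
  push Not at hbig
  have hcross : ∀ J ⊆ I, J.Nonempty → J ≠ I → k + 1 ≤ (A.filter (fun y => y ∉ I ∧
      (∃ i ∈ J, G.Adj y i) ∧ ∃ i ∈ I \ J, G.Adj y i)).card := by
    intro J hJ hJne hJI
    have b1 := hbig J hJ hJne hJI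
    have hss := Finset.ssubset_iff_subset_ne.2 ⟨hJ, hJI⟩
    have hsd : (I \ J).Nonempty := Finset.sdiff_nonempty.2 (fun h => hJI (Finset.Subset.antisymm hJ h))
    have b2 := hbig (I \ J) Finset.sdiff_subset hsd (by
      intro h
      obtain ⟨j, hj⟩ := hJne
      have := hJ hj
      rw [← h] at this
      exact (Finset.mem_sdiff.1 this).2 hj)
    have hcov : A ⊆ AJ J ∪ AJ (I \ J) ∪ (A.filter (fun y => y ∉ I ∧
      (∃ i ∈ J, G.Adj y i) ∧ ∃ i ∈ I \ J, G.Adj y i)) := by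
      intro x hx
      by_contra hnot
      simp only [Finset.mem_union, not_or] at hnot
      obtain ⟨⟨n1, n2⟩, n3⟩ := hnot
      simp only [AJ, Finset.mem_filter, hx, true_and, not_forall, Finset.sdiff_sdiff_eq_self hJ]
        at n1 n2 n3
      obtain ⟨i, hi, hi'⟩ := n1
      obtain ⟨j, hj, hj'⟩ := n2
      have hiI := (Finset.mem_sdiff.1 hi).1
      have hiJ := (Finset.mem_sdiff.1 hi).2
      have hij : i ≠ j := fun e => hiJ (e ▸ hj)
      have hnadj : ¬ G.Adj i j := hII hiI (hJ hj) hij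
      have hxi : x = i ∨ G.Adj x i := by tauto
      have hxj : x = j ∨ G.Adj x j := by tauto
      have hxi' : G.Adj x i := by
        rcases hxi with rfl | h
        · rcases hxj with h | h
          · exact absurd h hij
          · exact absurd h hnadj
        · exact h
      have hxj' : G.Adj x j := by
        rcases hxj with rfl | h
        · exact absurd hxi'.symm hnadj
        · exact h
      refine n3 ⟨fun hxI => hII hxI hiI hxi'.ne hxi', ⟨j, hj, hxj'⟩, ⟨i, hi, hxi'⟩⟩
    have c1 := Finset.card_le_card hcov
    have c2 := Finset.card_union_le (AJ J ∪ AJ (I \ J)) (A.filter (fun y => y ∉ I ∧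
      (∃ i ∈ J, G.Adj y i) ∧ ∃ i ∈ I \ J, G.Adj y i))
    have c3 := Finset.card_union_le (AJ J) (AJ (I \ J))
    have d1 : J.card + (I \ J).card = I.card := by
      rw [Finset.card_sdiff_of_subset hJ]
      have := Finset.card_le_card hJ
      omega
    have p1 := Finset.card_pos.2 hJne
    have p2 := Finset.card_pos.2 hsd
    have : (2 * I.card - 1) * (k + 1) =
        (2 * J.card - 1) * (k + 1) + (2 * (I \ J).card - 1) * (k + 1) + (k + 1) := by
      have : 2 * I.card - 1 = (2 * J.card - 1) + (2 * (I \ J).card - 1) + 1 := by omega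
      rw [this]; ring
    omega
  -- the immersion in A \ I
  have hcardsd : (A \ I).card = A.card - I.card := Finset.card_sdiff_of_subset hIA
  have hIleA := Finset.card_le_card hIA
  obtain ⟨M, hM, hMk, c, hc⟩ := ih (A \ I).card (by omega) (A \ I) I.card k rfl hIpos
    (fun S hS => hmax S (hS.trans Finset.sdiff_subset)) (by
      rw [hcardsd]
      have : (2 * I.card - 1) * (k + 1) = (2 * I.card - 1) * k + (2 * I.card - 1) := by ring
      omega)
  have hMA : ∀ m ∈ M, m ∈ A ∧ m ∉ I := fun m hm => Finset.mem_sdiff.1 (hM hm)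
  let B : SimpleGraph V :=
    { Adj := fun a b => G.Adj a b ∧ a ∈ A ∧ b ∈ A ∧ (a ∈ I ∨ b ∈ I)
      symm := ⟨fun a b h => ⟨h.1.symm, h.2.2.1, h.2.1, h.2.2.2.symm⟩⟩
      loopless := ⟨fun a h => h.1.ne rfl⟩ }
  have hBG : B ≤ G := fun a b h => h.1
  have htM : t ∉ M := fun h => (hMA t h).2 htI
  obtain ⟨c', hc'⟩ := im_fan B t M htM (by
    intro X htX
    have surj : ∀ Y : Finset V, (∀ y ∈ Y, y ∉ I ∧ ∃ q ∈ (X ×ˢ Xᶜ).filter (fun q => B.Adj q.1 q.2),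
        (q.1 = y ∨ q.2 = y)) → Y.card ≤ ((X ×ˢ Xᶜ).filter (fun q => B.Adj q.1 q.2)).card := by
      intro Y hY
      apply Finset.card_le_card_of_surjOn (fun q => if q.1 ∈ I then q.2 else q.1)
      intro y hy
      obtain ⟨hyI, q, hq, hqy⟩ := hY y hy
      refine ⟨q, hq, ?_⟩
      have hadj : B.Adj q.1 q.2 := (Finset.mem_filter.1 hq).2
      rcases hqy with h | h
      · simp [h, hyI]
      · have : q.1 ∈ I := by
          rcases hadj.2.2.2 with h' | h'
          · exact h'
          · exact absurd (h ▸ h') hyI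
        simp [this, h]
    by_cases hJ : (I ∩ X).Nonempty
    · refine le_trans (Finset.card_le_card Finset.inter_subset_left) ?_
      have hcr := hcross (I ∩ X) Finset.inter_subset_left hJ
        (fun h => htX (Finset.mem_inter.1 (h.symm ▸ htI : t ∈ I ∩ X)).2)
      refine le_trans (by omega) (le_trans hcr ((surj _ ?_).trans_eq (by congr!)))
      intro y hy
      obtain ⟨hyA, hyI, ⟨i, hi, hyi⟩, ⟨j, hj, hyj⟩⟩ := Finset.mem_filter.1 hy
      refine ⟨hyI, ?_⟩
      simp only [Finset.mem_inter] at hi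
      simp only [Finset.mem_sdiff, Finset.mem_inter, not_and] at hj
      by_cases hyX : y ∈ X
      · refine ⟨(y, j), ?_, Or.inl rfl⟩
        simp only [Finset.mem_filter, Finset.mem_product, Finset.mem_compl]
        exact ⟨⟨hyX, hj.2 hj.1⟩, hyj, hyA, hIA hj.1, Or.inr hj.1⟩
      · refine ⟨(i, y), ?_, Or.inr rfl⟩
        simp only [Finset.mem_filter, Finset.mem_product, Finset.mem_compl]
        exact ⟨⟨hi.2, hyX⟩, hyi.symm, hIA hi.1, hyA, Or.inl hi.1⟩
    · refine (surj _ ?_).trans_eq (by congr!)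
      intro m hm
      obtain ⟨hmM, hmX⟩ := Finset.mem_inter.1 hm
      obtain ⟨hmA, hmI⟩ := hMA m hmM
      refine ⟨hmI, ?_⟩
      have : ∃ i ∈ I, G.Adj m i := by
        by_contra hno
        push Not at hno
        have := hmax (insert m I) (Finset.insert_subset hmA hIA) (by
          intro x hx y hy hxy
          simp only [Finset.coe_insert, Set.mem_insert_iff, Finset.mem_coe] at hx hy
          rcases hx with rfl | hx <;> rcases hy with rfl | hy
          · exact absurd rfl hxy
          · exact hno y hy
          · exact fun h => hno x hx h.symm
          · exact hII hx hy hxy)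
        rw [Finset.card_insert_of_notMem hmI] at this
        omega
      obtain ⟨i, hi, hmi⟩ := this
      refine ⟨(m, i), ?_, Or.inl rfl⟩
      simp only [Finset.mem_filter, Finset.mem_product, Finset.mem_compl]
      exact ⟨⟨hmX, fun h => hJ ⟨i, Finset.mem_inter.2 ⟨hi, h⟩⟩⟩, hmi, hmA, hIA hi, Or.inr hi⟩)
  -- combine
  have fanW : ∀ m ∈ M, ∃ p : G.Walk m t, (∀ x ∈ p.support, x ∈ A) ∧
      ∀ e ∈ p.edges, (∃ i ∈ I, i ∈ e) ∧ c' e = m := by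
    intro m hm
    obtain ⟨p, hp⟩ := hc' m hm
    refine ⟨p.mapLe hBG, ?_, ?_⟩
    · intro x hx
      rw [SimpleGraph.Walk.support_mapLe_eq_support] at hx
      have : ∀ (a b : V) (q : B.Walk a b), a ∈ A → ∀ x ∈ q.support, x ∈ A := by
        intro a b q
        induction q with
        | nil => intro ha x hx; simp at hx; exact hx ▸ ha
        | cons h q ih =>
          intro ha x hx
          simp only [SimpleGraph.Walk.support_cons, List.mem_cons] at hx
          rcases hx with rfl | hx
          · exact ha
          · exact ih h.2.2.1 x hx
      exact this _ _ p (hMA m hm).1 x hx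
    · intro e he
      rw [SimpleGraph.Walk.edges_mapLe_eq_edges] at he
      refine ⟨?_, hp e he⟩
      have := p.edges_subset_edgeSet he
      induction e using Sym2.ind with
      | _ a b =>
        rw [SimpleGraph.mem_edgeSet] at this
        rcases this.2.2.2 with h | h
        · exact ⟨a, h, by simp⟩
        · exact ⟨b, h, by simp⟩
  refine ⟨insert t M, Finset.insert_subset (hIA htI) (fun m hm => (hMA m hm).1),
    by rw [Finset.card_insert_of_notMem htM, hMk],
    fun e => if ∃ i ∈ I, i ∈ e then s(c' e, t) else c e, ?_⟩
  intro u hu v hv huv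
  rw [Finset.mem_insert] at hu hv
  rcases hu with rfl | hu <;> rcases hv with rfl | hv
  · exact absurd rfl huv
  · obtain ⟨p, hp1, hp2⟩ := fanW v hv
    refine ⟨p.reverse, fun x hx => hp1 x (by simpa using hx), fun e he => ?_⟩
    have := hp2 e (by simpa using he)
    simp only [if_pos this.1, this.2]
    exact Sym2.eq_swap
  · obtain ⟨p, hp1, hp2⟩ := fanW u hu
    refine ⟨p, hp1, fun e he => ?_⟩
    have := hp2 e he
    simp only [if_pos this.1, this.2]
  · obtain ⟨p, hp1, hp2⟩ := hc u hu v hv huv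
    refine ⟨p, fun x hx => (Finset.mem_sdiff.1 (hp1 x hx)).1, fun e he => ?_⟩
    have : ¬ ∃ i ∈ I, i ∈ e := by
      rintro ⟨i, hi, hie⟩
      induction e using Sym2.ind with
      | _ a b =>
        rw [Sym2.mem_iff] at hie
        rcases hie with rfl | rfl
        · exact (Finset.mem_sdiff.1 (hp1 _ (p.fst_mem_support_of_mem_edges he))).2 hi
        · exact (Finset.mem_sdiff.1 (hp1 _ (p.snd_mem_support_of_mem_edges he))).2 hi
    simp only [if_neg this]
    exact hp2 e he

theorem clique_immersion_of_small_indepNum {V : Type*} [Fintype V] (G : SimpleGraph V)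
    (n α : ℕ) (hn : Fintype.card V = n) (hα1 : 1 ≤ α) (hα10 : α ≤ 10)
    (hind : IndepNumEq G α) :
    ∃ k : ℕ, ⌊(n : ℚ) / (2 * (α : ℚ))⌋ - 1 ≤ (k : ℤ) ∧ CliqueImmersion G k := by
  refine ⟨n / (2 * α), ?_, ?_⟩
  · have h : ⌊(n : ℚ) / (2 * (α : ℚ))⌋ = ((n / (2 * α) : ℕ) : ℤ) := by
      have := Rat.floor_intCast_div_natCast (n : ℤ) (2 * α)
      push_cast at this ⊢
      exact this
    rw [h]; omega
  · refine ImIn.cliqueImmersion (im_main G _ Finset.univ α _ rfl hα1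
      (fun I _ hI => hind.2 I hI) ?_)
    rw [Finset.card_univ, hn]
    calc (2 * α - 1) * (n / (2 * α)) ≤ (2 * α) * (n / (2 * α)) :=
          Nat.mul_le_mul_right _ (by omega)
      _ ≤ n := Nat.mul_div_le n (2 * α)
end
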